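/- arXiv:2312.12238 — 3 statements merged into one kernel-verified Lean document; each statement's English description precedes it below -/
import Mathlib

section
/- Under the Setup, a right S-module m is Gorenstein injective over S if and only if G(m) is Gorenstein injective over R. -/
/-!
Statement 4: Under the Setup (R, S Gorenstein rings, adjoint triple L ⊣ G ⊣ R′ of additive
functors between the categories of right modules, with G fully faithful and L exact), a right
S-module m is Gorenstein injective over S iff G(m) is Gorenstein injective over R.
Gorenstein injectivity is expressed (as in the reference, over Gorenstein rings) by the
vanishing of Ext^i(E, −) for i ≥ 1 against all modules E of finite injective dimension.
Right A-modules are formalized as objects of `ModuleCat Aᵐᵒᵖ`.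
-/

open CategoryTheory CategoryTheory.Abelian CategoryTheory.Limits

universe u

noncomputable instance moduleCatHasExt (A : Type u) [Ring A] :
    HasExt.{u + 1} (ModuleCat.{u} A) := by
  letI := HasDerivedCategory.standard (ModuleCat.{u} A)
  exact hasExt_of_hasDerivedCategory _

/-- `M` has finite projective dimension: there is `d` such that `Ext^i(M, N) = 0`
for every module `N` and every `i > d`. -/
def HasFinProjDim (A : Type u) [Ring A] (M : ModuleCat.{u} A) : Prop :=
  ∃ d : ℕ, ∀ (N : ModuleCat.{u} A) (i : ℕ), d < i → Subsingleton (Ext M N i)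

/-- `M` has finite injective dimension: there is `d` such that `Ext^i(N, M) = 0`
for every module `N` and every `i > d`. -/
def HasFinInjDim (A : Type u) [Ring A] (M : ModuleCat.{u} A) : Prop :=
  ∃ d : ℕ, ∀ (N : ModuleCat.{u} A) (i : ℕ), d < i → Subsingleton (Ext N M i)

/-- A ring is Gorenstein if it is left and right Noetherian and has finite injective
dimension as a right module and as a left module over itself. -/
def IsGorensteinRing (A : Type u) [Ring A] : Prop :=
  IsNoetherianRing A ∧ IsNoetherianRing Aᵐᵒᵖ ∧
    HasFinInjDim Aᵐᵒᵖ (ModuleCat.of Aᵐᵒᵖ A) ∧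
    HasFinInjDim A (ModuleCat.of A A)

/-- `M` is Gorenstein injective: `Ext^i(E, M) = 0` for all `i ≥ 1` and all modules `E`
of finite injective dimension. -/
def IsGorensteinInjective (A : Type u) [Ring A] (M : ModuleCat.{u} A) : Prop :=
  ∀ E : ModuleCat.{u} A, HasFinInjDim A E → ∀ i : ℕ, 1 ≤ i → Subsingleton (Ext E M i)

section ExtAdjunction

universe w w' v₁ v₂ u₁ u₂

variable {C : Type u₁} [Category.{v₁} C] [Abelian C] {D : Type u₂} [Category.{v₂} D] [Abelian D]
  [HasExt.{w} C] [HasExt.{w'} D] {L : C ⥤ D} {G : D ⥤ C} [L.Additive]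
  [PreservesFiniteLimits L] [PreservesFiniteColimits L]

/-- The map `Ext X (G Y) n → Ext (L X) Y n` induced by an adjunction `L ⊣ G` with `L` exact. -/
noncomputable def extAdjunctionHom (adj : L ⊣ G) (X : C) (Y : D) (n : ℕ) :
    Ext.{w} X (G.obj Y) n →+ Ext.{w'} (L.obj X) Y n :=
  ((Ext.mk₀ (adj.counit.app Y)).postcomp (L.obj X) (add_zero n)).comp
    (L.mapExtAddHom X (G.obj Y) n)

lemma extAdjunctionHom_apply (adj : L ⊣ G) {X : C} {Y : D} {n : ℕ} (e : Ext.{w} X (G.obj Y) n) :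
    extAdjunctionHom adj X Y n e =
      (e.mapExactFunctor L).comp (Ext.mk₀ (adj.counit.app Y)) (add_zero n) := rfl

attribute [local instance] Ext.subsingleton_of_projective in
lemma extAdjunctionHom_bijective [EnoughProjectives C] [G.PreservesEpimorphisms] (adj : L ⊣ G)
    (X : C) (Y : D) (n : ℕ) :
    Function.Bijective (extAdjunctionHom.{w, w'} adj X Y n) := by
  have : L.PreservesProjectiveObjects :=
    Functor.preservesProjectiveObjects_of_adjunction_of_preservesEpimorphisms adj
  induction n generalizing X with
  | zero =>
    have h : ⇑(extAdjunctionHom.{w, w'} adj X Y 0) =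
        Ext.homEquiv₀.symm ∘ (adj.homEquiv X Y).symm ∘ Ext.homEquiv₀ := by
      ext e
      obtain ⟨f, rfl⟩ := (Ext.mk₀_bijective _ _).2 e
      simp [extAdjunctionHom_apply, Ext.mapExactFunctor_mk₀, Ext.homEquiv₀,
        Adjunction.homEquiv_counit]
    rw [h]
    exact (Equiv.bijective _).comp ((Equiv.bijective _).comp (Equiv.bijective _))
  | succ n hn =>
    let P : ProjectivePresentation X := Classical.arbitrary _
    let T := ShortComplex.mk _ _ (kernel.condition P.f)
    have : Projective (T.map L).X₂ := Functor.PreservesProjectiveObjects.projective_obj P.projective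
    have hT : T.ShortExact := { exact := ShortComplex.exact_kernel P.f }
    have hLT := hT.map_of_exact L
    exact AddMonoidHom.bijective_of_surjective_of_bijective_of_right_exact _ _ _ _
      (extAdjunctionHom adj T.X₂ Y n) (extAdjunctionHom adj T.X₁ Y n)
      (extAdjunctionHom adj T.X₃ Y (n + 1))
      (by
        ext e
        change (Ext.mk₀ (L.map T.f)).comp (extAdjunctionHom adj T.X₂ Y n e) (zero_add n) =
          extAdjunctionHom adj T.X₁ Y n ((Ext.mk₀ T.f).comp e (zero_add n))
        rw [extAdjunctionHom_apply, extAdjunctionHom_apply, Ext.mapExactFunctor_comp,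
          Ext.mapExactFunctor_mk₀]
        exact (Ext.comp_assoc _ _ _ _ _ (by lia)).symm)
      (by
        ext e
        change hLT.extClass.comp (extAdjunctionHom adj T.X₁ Y n e) (add_comm 1 n) =
          extAdjunctionHom adj T.X₃ Y (n + 1) (hT.extClass.comp e (add_comm 1 n))
        rw [extAdjunctionHom_apply, extAdjunctionHom_apply, Ext.mapExactFunctor_comp,
          Ext.mapExactFunctor_extClass]
        exact (Ext.comp_assoc _ _ _ _ _ (by lia)).symm)
      ((ShortComplex.ab_exact_iff_function_exact _).1
        (Ext.contravariant_sequence_exact₁' hT (G.obj Y) n (n + 1) (add_comm 1 n)))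
      ((ShortComplex.ab_exact_iff_function_exact _).1
        (Ext.contravariant_sequence_exact₁' hLT Y n (n + 1) (add_comm 1 n)))
      (hn _).surjective (hn _)
      (fun x₃ ↦ Ext.contravariant_sequence_exact₃ hT _ x₃ (by subsingleton) (add_comm 1 n))
      (fun y₃ ↦ Ext.contravariant_sequence_exact₃ hLT _ y₃ (by subsingleton) (add_comm 1 n))

lemma subsingleton_ext_iff_of_adjunction [EnoughProjectives C] [G.PreservesEpimorphisms]
    (adj : L ⊣ G) (X : C) (Y : D) (n : ℕ) :
    Subsingleton (Ext.{w} X (G.obj Y) n) ↔ Subsingleton (Ext.{w'} (L.obj X) Y n) :=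
  (Equiv.ofBijective _ (extAdjunctionHom_bijective adj X Y n)).subsingleton_congr

end ExtAdjunction

section FiniteModules

/-- Over a Noetherian ring, this characterizes flat modules: the inclusion of every finitely
generated submodule factors through a finite free module. -/
def InclusionsFactorThroughFree (A : Type u) [Ring A] (Y : Type u) [AddCommGroup Y] [Module A Y] :
    Prop :=
  ∀ V : Submodule A Y, V.FG → ∃ (n : ℕ) (a : V →ₗ[A] (Fin n → A)) (b : (Fin n → A) →ₗ[A] Y),
    b ∘ₗ a = V.subtype

lemma inclusionsFactorThroughFree_finsupp (A : Type u) [Ring A] (ι : Type u) :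
    InclusionsFactorThroughFree A (ι →₀ A) := by
  classical
  rintro V ⟨t, rfl⟩
  let s : Finset ι := t.biUnion Finsupp.support
  have hs : ∀ x ∈ Submodule.span A (t : Set (ι →₀ A)), (x.support : Set ι) ⊆ s := by
    intro x hx
    have : Submodule.span A (t : Set (ι →₀ A)) ≤ Finsupp.supported A A (s : Set ι) := by
      rw [Submodule.span_le]
      intro y hy
      simp only [Finsupp.mem_supported, SetLike.mem_coe, Finset.coe_subset]
      exact Finset.subset_biUnion_of_mem _ hy
    exact (Finsupp.mem_supported A x).1 (this hx)
  let e := s.equivFin.symm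
  refine ⟨s.card, LinearMap.pi (fun i ↦ Finsupp.lapply (e i : ι)) ∘ₗ Submodule.subtype _,
    ∑ i, Finsupp.lsingle (e i : ι) ∘ₗ LinearMap.proj i, ?_⟩
  ext x j
  simp only [LinearMap.coe_comp, Function.comp_apply, LinearMap.coe_sum, Finset.sum_apply,
    LinearMap.pi_apply, LinearMap.proj_apply, Finsupp.lapply_apply, Submodule.subtype_apply,
    Finsupp.lsingle_apply]
  rw [e.sum_comp (fun i : s ↦ Finsupp.single (i : ι) (x.1 i)),
    Finset.sum_coe_sort s (fun i ↦ Finsupp.single i (x.1 i))]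
  conv_rhs => rw [← x.1.sum_single]
  rw [Finsupp.sum_of_support_subset _ (by exact_mod_cast hs x.1 x.2) _ (by simp)]

variable {A B : Type u} [Ring A] [Ring B]

lemma exists_fg_submodule_mem_range {L : ModuleCat.{u} A ⥤ ModuleCat.{u} B}
    {G : ModuleCat.{u} B ⥤ ModuleCat.{u} A} [G.Additive] (adj : L ⊣ G) (Y : ModuleCat.{u} A)
    (z : L.obj Y) :
    ∃ V : Submodule A Y, V.FG ∧ z ∈ (L.map (ModuleCat.ofHom V.subtype)).hom.range := by
  let r (V : Submodule A Y) := (L.map (ModuleCat.ofHom V.subtype)).hom.range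
  have hr {V V' : Submodule A Y} (h : V ≤ V') : r V ≤ r V' := by
    have : ModuleCat.ofHom V.subtype =
        ModuleCat.ofHom (Submodule.inclusion h) ≫ ModuleCat.ofHom V'.subtype := rfl
    simp only [r]
    rw [this, L.map_comp, ModuleCat.hom_comp]
    exact LinearMap.range_comp_le_range _ _
  let W : Submodule B (L.obj Y) := ⨆ V : {V : Submodule A Y // V.FG}, r V.1
  have hdir : Directed (· ≤ ·) (fun V : {V : Submodule A Y // V.FG} ↦ r V.1) := fun V V' ↦
    ⟨⟨V.1 ⊔ V'.1, V.2.sup V'.2⟩, hr le_sup_left, hr le_sup_right⟩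
  have hW : W = ⊤ := by
    let q : L.obj Y ⟶ ModuleCat.of B (L.obj Y ⧸ W) := ModuleCat.ofHom W.mkQ
    have hq : adj.homEquiv _ _ q = 0 := by
      ext y
      let V : Submodule A Y := Submodule.span A {y}
      have h0 : L.map (ModuleCat.ofHom V.subtype) ≫ q = 0 := by
        ext v
        simp only [q, ModuleCat.hom_comp, LinearMap.comp_apply, ModuleCat.hom_zero,
          LinearMap.zero_apply, ModuleCat.hom_ofHom, Submodule.mkQ_apply,
          Submodule.Quotient.mk_eq_zero]
        exact Submodule.mem_iSup_of_mem (⟨V, Submodule.fg_span_singleton y⟩ :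
          {V : Submodule A Y // V.FG}) ⟨v, rfl⟩
      have h1 : ModuleCat.ofHom V.subtype ≫ adj.homEquiv _ _ q = 0 := by
        rw [← Adjunction.homEquiv_naturality_left, h0, Adjunction.homEquiv_unit, G.map_zero,
          comp_zero]
      exact congr($(h1).hom ⟨y, Submodule.mem_span_singleton_self y⟩)
    have hq0 : q = 0 := by
      apply (adj.homEquiv _ _).injective
      rw [hq, Adjunction.homEquiv_unit, G.map_zero, comp_zero]
    rw [eq_top_iff]
    intro x _
    rw [← Submodule.Quotient.mk_eq_zero]
    exact congr($(hq0).hom x)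
  have hz : z ∈ W := hW ▸ Submodule.mem_top
  have : Nonempty {V : Submodule A Y // V.FG} := ⟨⟨⊥, Submodule.fg_bot⟩⟩
  obtain ⟨V, hV⟩ := (Submodule.mem_iSup_of_directed _ hdir).1 hz
  exact ⟨V.1, V.2, hV⟩

lemma exists_fg_submodule_range_le {L : ModuleCat.{u} A ⥤ ModuleCat.{u} B}
    {G : ModuleCat.{u} B ⥤ ModuleCat.{u} A} [G.Additive] (adj : L ⊣ G) (Y : ModuleCat.{u} A)
    (N : Submodule B (L.obj Y)) (hN : N.FG) :
    ∃ V : Submodule A Y, V.FG ∧ N ≤ (L.map (ModuleCat.ofHom V.subtype)).hom.range := by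
  obtain ⟨t, rfl⟩ := hN
  choose V hV hz using exists_fg_submodule_mem_range adj Y
  refine ⟨t.sup V, ?_, ?_⟩
  · exact Submodule.fg_finset_sup _ _ fun z _ ↦ hV z
  · rw [Submodule.span_le]
    intro z hzt
    obtain ⟨x, hx⟩ := hz z
    have h : V z ≤ t.sup V := Finset.le_sup hzt
    refine ⟨(L.map (ModuleCat.ofHom (Submodule.inclusion h))).hom x, Eq.trans ?_ hx⟩
    rw [← LinearMap.comp_apply, ← ModuleCat.hom_comp, ← L.map_comp]
    rfl

lemma exists_fg_submodule_ext_comp_eq [IsNoetherianRing B] {L : ModuleCat.{u} A ⥤ ModuleCat.{u} B}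
    {G : ModuleCat.{u} B ⥤ ModuleCat.{u} A} [G.Additive] [PreservesFiniteLimits L] (adj : L ⊣ G)
    (Y : ModuleCat.{u} A) (k : ℕ) (N : ModuleCat.{u} B) [Module.Finite B N]
    (e : Ext N (L.obj Y) k) :
    ∃ V : Submodule A Y, V.FG ∧ ∃ e' : Ext N (L.obj (ModuleCat.of A V)) k,
      e'.comp (Ext.mk₀ (L.map (ModuleCat.ofHom V.subtype))) (add_zero k) = e := by
  induction k generalizing N with
  | zero =>
    obtain ⟨f, rfl⟩ := (Ext.mk₀_bijective _ _).2 e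
    obtain ⟨V, hV, hle⟩ := exists_fg_submodule_range_le adj Y f.hom.range
      (Module.Finite.iff_fg.1 inferInstance)
    have : Mono (ModuleCat.ofHom V.subtype) :=
      (ModuleCat.mono_iff_injective _).2 V.injective_subtype
    have hinj := (ModuleCat.mono_iff_injective (L.map (ModuleCat.ofHom V.subtype))).1 inferInstance
    let i := LinearEquiv.ofInjective _ hinj
    refine ⟨V, hV, Ext.mk₀ (ModuleCat.ofHom (i.symm.toLinearMap ∘ₗ
      f.hom.codRestrict _ fun x ↦ hle ⟨x, rfl⟩)), ?_⟩
    rw [Ext.mk₀_comp_mk₀]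
    congr 1
    ext x
    exact congr_arg Subtype.val (i.apply_symm_apply ⟨f.hom x, hle ⟨x, rfl⟩⟩)
  | succ k ih =>
    obtain ⟨n, p, hp⟩ := Module.Finite.exists_fin' B N
    have hT := LinearMap.shortExact_shortComplexKer hp
    have : Projective (ModuleCat.of B (Fin n → B)) := inferInstance
    have : Module.Finite B (LinearMap.ker p) := inferInstance
    obtain ⟨x, rfl⟩ := Ext.contravariant_sequence_exact₃ hT _ e (Ext.eq_zero_of_projective _)
      (add_comm 1 k)
    obtain ⟨V, hV, x', rfl⟩ := ih (ModuleCat.of B (LinearMap.ker p)) x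
    exact ⟨V, hV, hT.extClass.comp x' (add_comm 1 k), by
      rw [Ext.comp_assoc _ _ _ _ _ (by lia)]⟩

lemma subsingleton_ext_of_inclusionsFactorThroughFree [IsNoetherianRing B]
    {L : ModuleCat.{u} A ⥤ ModuleCat.{u} B} {G : ModuleCat.{u} B ⥤ ModuleCat.{u} A} [G.Additive]
    [PreservesFiniteLimits L] (adj : L ⊣ G) (N : ModuleCat.{u} B) [Module.Finite B N] (k : ℕ)
    (h : ∀ n : ℕ, Subsingleton (Ext N (L.obj (ModuleCat.of A (Fin n → A))) k))
    (Y : ModuleCat.{u} A) (hY : InclusionsFactorThroughFree A Y) :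
    Subsingleton (Ext N (L.obj Y) k) := by
  refine subsingleton_of_forall_eq 0 fun e ↦ ?_
  obtain ⟨V, hV, e', rfl⟩ := exists_fg_submodule_ext_comp_eq adj Y k N e
  obtain ⟨n, a, b, hab⟩ := hY V hV
  rw [← hab, ModuleCat.ofHom_comp, L.map_comp, ← Ext.mk₀_comp_mk₀,
    ← Ext.comp_assoc _ _ _ (add_zero k) _ (by lia),
    (h n).elim (e'.comp (Ext.mk₀ (L.map (ModuleCat.ofHom a))) (add_zero k)) 0, Ext.zero_comp]

lemma hasInjectiveDimensionLT_fin_fun {d : ℕ} [HasInjectiveDimensionLT (ModuleCat.of B B) (d + 1)]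
    (n : ℕ) : HasInjectiveDimensionLT (ModuleCat.of B (Fin n → B)) (d + 1) := by
  induction n with
  | zero =>
    have h : IsZero (ModuleCat.of B (Fin 0 → B)) :=
      ModuleCat.isZero_of_iff_subsingleton.2 inferInstance
    have := h.hasInjectiveDimensionLT_zero
    exact hasInjectiveDimensionLT_of_ge _ 0 _ (by lia)
  | succ n ih =>
    exact hasInjectiveDimensionLT_of_iso (ModuleCat.biprodIsoProd (ModuleCat.of B B)
      (ModuleCat.of B (Fin n → B)) ≪≫ (Fin.consLinearEquiv B fun _ ↦ B).toModuleIso) _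

lemma subsingleton_ext_of_projective_of_finite [IsNoetherianRing B] {d : ℕ}
    [HasInjectiveDimensionLT (ModuleCat.of B B) (d + 1)] (N Q : ModuleCat.{u} B)
    [Module.Finite B N] [Projective Q] (k : ℕ) (hk : d < k) : Subsingleton (Ext N Q k) := by
  have : Subsingleton (Ext N (ModuleCat.of B (Q →₀ B)) k) :=
    subsingleton_ext_of_inclusionsFactorThroughFree (Adjunction.id (C := ModuleCat.{u} B)) N k
      (fun n ↦
        have := hasInjectiveDimensionLT_fin_fun (B := B) (d := d) n
        HasInjectiveDimensionLT.subsingleton (ModuleCat.of B (Fin n → B)) (d + 1) k hk N)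
      (ModuleCat.of B (Q →₀ B)) (inclusionsFactorThroughFree_finsupp B Q)
  let p : ModuleCat.of B (Q →₀ B) ⟶ Q := ModuleCat.ofHom (Finsupp.linearCombination B id)
  have : Epi p := (ModuleCat.epi_iff_surjective _).2 (Finsupp.linearCombination_id_surjective B Q)
  refine subsingleton_of_forall_eq 0 fun e ↦ ?_
  rw [← e.comp_mk₀_id, ← Projective.factorThru_comp (𝟙 Q) p, ← Ext.mk₀_comp_mk₀,
    ← Ext.comp_assoc _ _ _ (add_zero k) _ (by lia),
    Subsingleton.elim (e.comp (Ext.mk₀ (Projective.factorThru (𝟙 Q) p)) (add_zero k)) 0,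
    Ext.zero_comp]

lemma hasInjectiveDimensionLT_of_finite (d : ℕ) (W : ModuleCat.{u} B)
    (h : ∀ (N : ModuleCat.{u} B) [Module.Finite B N], Subsingleton (Ext N W (d + 1))) :
    HasInjectiveDimensionLT W (d + 1) := by
  induction d generalizing W with
  | zero =>
    rw [← injective_iff_hasInjectiveDimensionLT_one]
    suffices Module.Injective B W from Module.injective_object_of_injective_module B W
    refine Module.Baer.injective fun I g ↦ ?_
    have hT := LinearMap.shortExact_shortComplexKer I.mkQ_surjective
    have := h (ModuleCat.of B (B ⧸ I))
    let g' : LinearMap.ker I.mkQ →ₗ[B] W := g ∘ₗ (LinearEquiv.ofEq _ _ I.ker_mkQ).toLinearMap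
    obtain ⟨x, hx⟩ := Ext.contravariant_sequence_exact₁ hT W (Ext.mk₀ (ModuleCat.ofHom g'))
      (add_zero 1) (this.elim _ _)
    obtain ⟨f, rfl⟩ := (Ext.mk₀_bijective _ _).2 x
    rw [Ext.mk₀_comp_mk₀] at hx
    have hfg := (Ext.mk₀_bijective _ _).1 hx
    exact ⟨f.hom, fun x hxI ↦ congr($(hfg).hom ⟨x, I.ker_mkQ.symm ▸ hxI⟩)⟩
  | succ d ih =>
    obtain ⟨J, _, f, _⟩ := EnoughInjectives.presentation W
    have hT : (ShortComplex.mk f (cokernel.π f) (cokernel.condition f)).ShortExact :=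
      { exact := ShortComplex.exact_cokernel f }
    refine (hT.hasInjectiveDimensionLT_X₃_iff d inferInstance).1 (ih _ fun N _ ↦ ?_)
    refine subsingleton_of_forall_eq 0 fun e ↦ ?_
    obtain ⟨x, rfl⟩ := Ext.covariant_sequence_exact₃ N hT e rfl ((h N).elim _ _)
    rw [x.eq_zero_of_injective, Ext.zero_comp]

/-- `Y` has a syzygy of order `n` (with respect to the standard free covers) all of whose finitely
generated submodules have inclusions factoring through finite free modules. -/
def SyzygyFactorsThroughFree (A : Type u) [Ring A] : ℕ → ModuleCat.{u} A → Prop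
  | 0, Y => InclusionsFactorThroughFree A Y
  | n + 1, Y => SyzygyFactorsThroughFree A n
      (ModuleCat.of A (LinearMap.ker (Finsupp.linearCombination A (id : Y → Y))))

lemma hasInjectiveDimensionLT_of_syzygyFactorsThroughFree [IsNoetherianRing B] {d : ℕ}
    [HasInjectiveDimensionLT (ModuleCat.of B B) (d + 1)]
    {L : ModuleCat.{u} A ⥤ ModuleCat.{u} B} {G : ModuleCat.{u} B ⥤ ModuleCat.{u} A} [L.Additive]
    [G.Additive] [PreservesFiniteLimits L] [PreservesFiniteColimits L]
    [G.PreservesEpimorphisms] (adj : L ⊣ G) (n : ℕ) (Y : ModuleCat.{u} A)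
    (hY : SyzygyFactorsThroughFree A n Y) :
    HasInjectiveDimensionLT (L.obj Y) (d + 1) := by
  have : L.PreservesProjectiveObjects :=
    Functor.preservesProjectiveObjects_of_adjunction_of_preservesEpimorphisms adj
  refine hasInjectiveDimensionLT_of_finite d _ fun N _ ↦ ?_
  suffices ∀ k, d < k → Subsingleton (Ext N (L.obj Y) k) from this _ d.lt_succ_self
  induction n generalizing Y with
  | zero =>
    intro k hk
    exact subsingleton_ext_of_inclusionsFactorThroughFree adj N k
      (fun n ↦ subsingleton_ext_of_projective_of_finite N _ k hk) Y hY
  | succ n ih =>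
    intro k hk
    have hT := (LinearMap.shortExact_shortComplexKer
      (Finsupp.linearCombination_id_surjective A Y)).map_of_exact L
    refine subsingleton_of_forall_eq 0 fun e ↦ ?_
    obtain ⟨x, rfl⟩ := Ext.covariant_sequence_exact₃ N hT e rfl
      ((ih _ hY (k + 1) (by lia)).elim _ _)
    have := subsingleton_ext_of_projective_of_finite N
      (L.obj (ModuleCat.of A (Y →₀ A))) k hk
    obtain rfl : x = 0 := this.elim _ _
    exact Ext.zero_comp (C := ModuleCat.{u} B) _ _ _ _ _

end FiniteModules

section DualComplexes

/-- Every linear map `B → Y` killing `f : X → B` extends along `g : B → C`. -/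
def ExtendsAlong {A : Type*} [Ring A] {X B C : Type*} [AddCommGroup X] [Module A X]
    [AddCommGroup B] [Module A B] [AddCommGroup C] [Module A C] (f : X →ₗ[A] B) (g : B →ₗ[A] C)
    (Y : Type*) [AddCommGroup Y] [Module A Y] : Prop :=
  ∀ φ : B →ₗ[A] Y, φ ∘ₗ f = 0 → ∃ ψ : C →ₗ[A] Y, ψ ∘ₗ g = φ

lemma ExtendsAlong.of_exact {A : Type*} [Ring A] {X B C D K P Y : Type*}
    [AddCommGroup X] [Module A X] [AddCommGroup B] [Module A B] [AddCommGroup C] [Module A C]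
    [AddCommGroup D] [Module A D] [AddCommGroup K] [Module A K] [AddCommGroup P] [Module A P]
    [AddCommGroup Y] [Module A Y] [Module.Projective A D]
    {f : X →ₗ[A] B} {g : B →ₗ[A] C} {h : C →ₗ[A] D} (hgh : h ∘ₗ g = 0)
    {i : K →ₗ[A] P} {p : P →ₗ[A] Y} (hi : Function.Injective i) (hp : Function.Surjective p)
    (hip : Function.Exact i p) (hP : ExtendsAlong f g P) (hY : ExtendsAlong g h Y) :
    ExtendsAlong f g K := by
  intro φ hφ
  obtain ⟨ψ, hψ⟩ := hP (i ∘ₗ φ) (by rw [LinearMap.comp_assoc, hφ, LinearMap.comp_zero])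
  obtain ⟨χ, hχ⟩ := hY (p ∘ₗ ψ) (by
    rw [LinearMap.comp_assoc, hψ, ← LinearMap.comp_assoc, hip.linearMap_comp_eq_zero,
      LinearMap.zero_comp])
  obtain ⟨χ', rfl⟩ := Module.projective_lifting_property p χ hp
  have hmem (c : C) : (ψ - χ' ∘ₗ h) c ∈ LinearMap.range i := by
    refine (hip _).1 ?_
    simpa [sub_eq_zero] using congr($(hχ.symm) c)
  refine ⟨(LinearEquiv.ofInjective i hi).symm.toLinearMap ∘ₗ
    (ψ - χ' ∘ₗ h).codRestrict _ hmem, ?_⟩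
  ext b
  apply hi
  have h0 : h (g b) = 0 := congr($hgh b)
  have h1 : ψ (g b) = i (φ b) := congr($hψ b)
  refine (congr_arg Subtype.val
    ((LinearEquiv.ofInjective i hi).apply_symm_apply ⟨_, hmem (g b)⟩)).trans ?_
  simp [h0, h1]

lemma extendsAlong_of_injective {A : Type u} [Ring A] {X B C : Type u}
    [AddCommGroup X] [Module A X] [AddCommGroup B] [Module A B] [AddCommGroup C] [Module A C]
    {f : X →ₗ[A] B} {g : B →ₗ[A] C} (hfg : Function.Exact f g) (J : ModuleCat.{u} A)
    [Injective J] : ExtendsAlong f g J := by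
  intro φ hφ
  let T : ShortComplex (ModuleCat.{u} A) := .mk (ModuleCat.ofHom f) (ModuleCat.ofHom g)
    (by rw [← ModuleCat.ofHom_comp, hfg.linearMap_comp_eq_zero]; rfl)
  have hT : T.Exact := (ShortComplex.ShortExact.moduleCat_exact_iff_function_exact T).2 hfg
  have h0 : T.f ≫ ModuleCat.ofHom φ = 0 := by
    ext x
    exact congr($hφ x)
  exact ⟨(hT.descToInjective (ModuleCat.ofHom φ) h0).hom,
    congr_arg ModuleCat.Hom.hom (hT.comp_descToInjective (ModuleCat.ofHom φ) h0)⟩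

lemma ExtendsAlong.finsupp {A : Type*} [Ring A] {X C : Type*} [AddCommGroup X] [Module A X]
    [AddCommGroup C] [Module A C] {n : ℕ} {f : X →ₗ[A] (Fin n → A)} {g : (Fin n → A) →ₗ[A] C}
    (h : ExtendsAlong f g A) (ι : Type*) : ExtendsAlong f g (ι →₀ A) := by
  classical
  intro φ hφ
  let s : Finset ι := Finset.univ.biUnion fun j ↦ (φ (Pi.single j 1)).support
  have hs (x : Fin n → A) : (φ x).support ⊆ s := by
    intro i hi
    by_contra his
    refine Finsupp.mem_support_iff.1 hi ?_
    have h0 : Finsupp.lapply i ∘ₗ φ = 0 := by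
      ext j
      by_contra hj
      exact his (Finset.mem_biUnion.2 ⟨j, Finset.mem_univ _, Finsupp.mem_support_iff.2
        (by simpa using hj)⟩)
    exact congr($h0 x)
  choose ψ hψ using fun i ↦ h (Finsupp.lapply i ∘ₗ φ) (by
    rw [LinearMap.comp_assoc, hφ, LinearMap.comp_zero])
  refine ⟨∑ i ∈ s, Finsupp.lsingle i ∘ₗ ψ i, LinearMap.ext fun x ↦ ?_⟩
  have hψ' (i : ι) : ψ i (g x) = φ x i := congr($(hψ i) x)
  simp only [LinearMap.coe_comp, Function.comp_apply, LinearMap.coe_sum, Finset.sum_apply,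
    Finsupp.lsingle_apply, hψ']
  exact (Finsupp.sum_of_support_subset _ (hs x) _ (by simp)).symm.trans (φ x).sum_single

variable {R : Type u} [Ring R]

/-- The dual of a free right module of rank `n` is the free left module of rank `n`. -/
def finDualEquiv (R : Type u) [Ring R] (n : ℕ) :
    ((Fin n → Rᵐᵒᵖ) →ₗ[Rᵐᵒᵖ] Rᵐᵒᵖ) ≃ₗ[R] (Fin n → R) where
  toFun φ j := (φ (Pi.single j 1)).unop
  map_add' _ _ := rfl
  map_smul' _ _ := rfl
  invFun c := ∑ j, c j • LinearMap.proj j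
  left_inv φ := by
    ext j
    apply MulOpposite.unop_injective
    simp [Pi.single_apply]
  right_inv c := by
    ext j
    simp [Pi.single_apply]

lemma eq_sum_smul_proj {n : ℕ} (φ : (Fin n → Rᵐᵒᵖ) →ₗ[Rᵐᵒᵖ] Rᵐᵒᵖ) :
    φ = ∑ j, (finDualEquiv R n φ) j • LinearMap.proj j :=
  ((finDualEquiv R n).symm_apply_apply φ).symm

instance (n : ℕ) : Module.Projective R ((Fin n → Rᵐᵒᵖ) →ₗ[Rᵐᵒᵖ] Rᵐᵒᵖ) :=
  Module.Projective.of_equiv (finDualEquiv R n).symm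

/-- Precomposition with a map of right modules, as a map of left modules. -/
def rightDualMap {M N : Type*} [AddCommGroup M] [Module Rᵐᵒᵖ M] [AddCommGroup N] [Module Rᵐᵒᵖ N]
    (f : M →ₗ[Rᵐᵒᵖ] N) : (N →ₗ[Rᵐᵒᵖ] Rᵐᵒᵖ) →ₗ[R] (M →ₗ[Rᵐᵒᵖ] Rᵐᵒᵖ) where
  toFun φ := φ ∘ₗ f
  map_add' _ _ := rfl
  map_smul' _ _ := rfl

lemma exists_extendsAlong_self [IsNoetherianRing R] {M : Type*} [AddCommGroup M] [Module Rᵐᵒᵖ M]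
    {m : ℕ} (f : M →ₗ[Rᵐᵒᵖ] (Fin m → Rᵐᵒᵖ)) :
    ∃ (k : ℕ) (g : (Fin m → Rᵐᵒᵖ) →ₗ[Rᵐᵒᵖ] (Fin k → Rᵐᵒᵖ)),
      g ∘ₗ f = 0 ∧ ExtendsAlong f g Rᵐᵒᵖ := by
  have : IsNoetherian R ((Fin m → Rᵐᵒᵖ) →ₗ[Rᵐᵒᵖ] Rᵐᵒᵖ) :=
    isNoetherian_of_linearEquiv (finDualEquiv R m).symm
  obtain ⟨k, φ, hφ⟩ := Submodule.fg_iff_exists_fin_generating_family.1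
    (IsNoetherian.noetherian (LinearMap.ker (rightDualMap f)))
  refine ⟨k, LinearMap.pi φ, ?_, fun χ hχ ↦ ?_⟩
  · ext x j
    have : φ j ∈ LinearMap.ker (rightDualMap f) := hφ ▸ Submodule.subset_span ⟨j, rfl⟩
    exact congr($(LinearMap.mem_ker.1 this) x)
  · have : χ ∈ Submodule.span R (Set.range φ) := hφ ▸ LinearMap.mem_ker.2 hχ
    obtain ⟨c, rfl⟩ := (Submodule.mem_span_range_iff_exists_fun R).1 this
    refine ⟨∑ j, c j • LinearMap.proj j, LinearMap.ext fun x ↦ ?_⟩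
    simp

/-- A complex of finite free right modules whose dual complex is exact. -/
structure IsDualExact (m : ℕ → ℕ)
    (f : ∀ i, (Fin (m i) → Rᵐᵒᵖ) →ₗ[Rᵐᵒᵖ] (Fin (m (i + 1)) → Rᵐᵒᵖ)) : Prop where
  comp_eq_zero (i : ℕ) : f (i + 1) ∘ₗ f i = 0
  extendsAlong (i : ℕ) : ExtendsAlong (f i) (f (i + 1)) Rᵐᵒᵖ

lemma exists_isDualExact [IsNoetherianRing R] [IsNoetherianRing Rᵐᵒᵖ] (V : Type*) [AddCommGroup V]
    [Module Rᵐᵒᵖ V] [Module.Finite Rᵐᵒᵖ V] :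
    ∃ (m : ℕ → ℕ) (f : ∀ i, (Fin (m i) → Rᵐᵒᵖ) →ₗ[Rᵐᵒᵖ] (Fin (m (i + 1)) → Rᵐᵒᵖ)),
      IsDualExact m f ∧ ∃ p : (Fin (m 1) → Rᵐᵒᵖ) →ₗ[Rᵐᵒᵖ] V,
        Function.Surjective p ∧ LinearMap.range (f 0) = LinearMap.ker p := by
  obtain ⟨b, p, hp⟩ := Module.Finite.exists_fin' Rᵐᵒᵖ V
  obtain ⟨a, q, hq⟩ := Module.Finite.exists_fin' Rᵐᵒᵖ (LinearMap.ker p)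
  choose k g hg₀ hg using fun (s : Σ a b : ℕ, (Fin a → Rᵐᵒᵖ) →ₗ[Rᵐᵒᵖ] (Fin b → Rᵐᵒᵖ)) ↦
    exists_extendsAlong_self s.2.2
  let s (i : ℕ) : Σ a b : ℕ, (Fin a → Rᵐᵒᵖ) →ₗ[Rᵐᵒᵖ] (Fin b → Rᵐᵒᵖ) :=
    Nat.rec ⟨a, b, (LinearMap.ker p).subtype ∘ₗ q⟩ (fun _ s ↦ ⟨s.2.1, k s, g s⟩) i
  refine ⟨fun i ↦ (s i).1, fun i ↦ (s i).2.2, ⟨fun i ↦ hg₀ (s i), fun i ↦ hg (s i)⟩, p, hp, ?_⟩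
  exact (LinearMap.range_comp_of_range_eq_top _ (LinearMap.range_eq_top.2 hq)).trans
    (Submodule.range_subtype _)

namespace IsDualExact

variable {m : ℕ → ℕ} {f : ∀ i, (Fin (m i) → Rᵐᵒᵖ) →ₗ[Rᵐᵒᵖ] (Fin (m (i + 1)) → Rᵐᵒᵖ)}

lemma exact_rightDualMap (hf : IsDualExact m f) (i : ℕ) :
    Function.Exact (rightDualMap (f (i + 1))) (rightDualMap (f i)) := fun φ ↦
  ⟨fun h ↦ hf.extendsAlong i φ h, by
    rintro ⟨ψ, rfl⟩
    change (ψ ∘ₗ f (i + 1)) ∘ₗ f i = 0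
    rw [LinearMap.comp_assoc, hf.comp_eq_zero, LinearMap.comp_zero]⟩

lemma extendsAlong_rightDualMap (hf : IsDualExact m f) (n : ℕ) (W : ModuleCat.{u} R)
    [HasInjectiveDimensionLT W (n + 1)] (i : ℕ) (hi : n ≤ i) :
    ExtendsAlong (rightDualMap (f (i + 1))) (rightDualMap (f i)) W := by
  induction n generalizing W i with
  | zero =>
    have : Injective W := injective_iff_hasInjectiveDimensionLT_one.2 inferInstance
    exact extendsAlong_of_injective (hf.exact_rightDualMap i) W
  | succ n ih =>
    obtain ⟨i, rfl⟩ : ∃ j, i = j + 1 := ⟨i - 1, by lia⟩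
    obtain ⟨J, _, j, _⟩ := EnoughInjectives.presentation W
    have hT : (ShortComplex.mk j (cokernel.π j) (cokernel.condition j)).ShortExact :=
      { exact := ShortComplex.exact_cokernel j }
    have := (hT.hasInjectiveDimensionLT_X₃_iff n inferInstance).2 inferInstance
    exact ExtendsAlong.of_exact (hf.exact_rightDualMap i).linearMap_comp_eq_zero
      hT.moduleCat_injective_f hT.moduleCat_surjective_g
      ((ShortComplex.ShortExact.moduleCat_exact_iff_function_exact _).1 hT.exact)
      (extendsAlong_of_injective (hf.exact_rightDualMap (i + 1)) J)
      (ih _ i (by lia))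

lemma exact (hf : IsDualExact m f) (n : ℕ)
    [HasInjectiveDimensionLT (ModuleCat.of R Rᵐᵒᵖ) (n + 1)] (i : ℕ) (hi : n ≤ i) :
    Function.Exact (f i) (f (i + 1)) := by
  intro y
  refine ⟨fun hy ↦ ?_, by rintro ⟨x, rfl⟩; exact congr($(hf.comp_eq_zero i) x)⟩
  let ev : ((Fin (m (i + 1)) → Rᵐᵒᵖ) →ₗ[Rᵐᵒᵖ] Rᵐᵒᵖ) →ₗ[R] Rᵐᵒᵖ :=
    { toFun := fun φ ↦ φ y
      map_add' := fun _ _ ↦ rfl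
      map_smul' := fun _ _ ↦ rfl }
  obtain ⟨Ψ, hΨ⟩ := hf.extendsAlong_rightDualMap n (ModuleCat.of R Rᵐᵒᵖ) i hi ev (by
    ext φ
    change φ (f (i + 1) y) = 0
    rw [hy, map_zero])
  refine ⟨fun j ↦ Ψ (LinearMap.proj j), ?_⟩
  have h (φ : (Fin (m i) → Rᵐᵒᵖ) →ₗ[Rᵐᵒᵖ] Rᵐᵒᵖ) : Ψ φ = φ (fun j ↦ Ψ (LinearMap.proj j)) := by
    rw [eq_sum_smul_proj φ]
    simp
  ext1 j
  exact (h (LinearMap.proj j ∘ₗ f i)).symm.trans congr($hΨ (LinearMap.proj j))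

end IsDualExact

lemma syzygyFactorsThroughFree_of_extendsAlong [IsNoetherianRing R] [IsNoetherianRing Rᵐᵒᵖ]
    (n : ℕ) (Y : ModuleCat.{u} Rᵐᵒᵖ)
    (hY : ∀ (m : ℕ → ℕ) (f : ∀ i, (Fin (m i) → Rᵐᵒᵖ) →ₗ[Rᵐᵒᵖ] (Fin (m (i + 1)) → Rᵐᵒᵖ)),
      IsDualExact m f → ∀ i, n ≤ i → ExtendsAlong (f i) (f (i + 1)) Y) :
    SyzygyFactorsThroughFree Rᵐᵒᵖ n Y := by
  induction n generalizing Y with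
  | zero =>
    intro V hV
    have : Module.Finite Rᵐᵒᵖ V := Module.Finite.iff_fg.2 hV
    obtain ⟨m, f, hf, p, hp, hpf⟩ := exists_isDualExact (R := R) V
    obtain ⟨b, hb⟩ := hY m f hf 0 le_rfl (V.subtype ∘ₗ p) (by
      rw [LinearMap.comp_assoc, (LinearMap.exact_iff.2 hpf.symm).linearMap_comp_eq_zero,
        LinearMap.comp_zero])
    refine ⟨_, (LinearMap.ker p).liftQ (f 1) ?_ ∘ₗ (p.quotKerEquivOfSurjective hp).symm, b, ?_⟩
    · rw [← hpf, LinearMap.range_le_ker_iff]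
      exact hf.comp_eq_zero 0
    · rw [← LinearMap.cancel_right hp, ← hb]
      ext x
      simp
  | succ n ih =>
    refine ih _ fun m f hf i hi ↦ ?_
    exact ExtendsAlong.of_exact (hf.comp_eq_zero (i + 1)) (Submodule.injective_subtype _)
      (Finsupp.linearCombination_id_surjective Rᵐᵒᵖ Y) (LinearMap.exact_subtype_ker_map _)
      ((hf.extendsAlong i).finsupp Y) (hY m f hf (i + 1) (by lia))

lemma syzygyFactorsThroughFree_of_injective [IsNoetherianRing R] [IsNoetherianRing Rᵐᵒᵖ]
    (n : ℕ) [HasInjectiveDimensionLT (ModuleCat.of R Rᵐᵒᵖ) (n + 1)] (E : ModuleCat.{u} Rᵐᵒᵖ)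
    [Injective E] : SyzygyFactorsThroughFree Rᵐᵒᵖ n E :=
  syzygyFactorsThroughFree_of_extendsAlong n E fun _ _ hf i hi ↦
    extendsAlong_of_injective (hf.exact n i hi) E

end DualComplexes

lemma hasFinInjDim_iff {A : Type u} [Ring A] (M : ModuleCat.{u} A) :
    HasFinInjDim A M ↔ ∃ d : ℕ, HasInjectiveDimensionLT M (d + 1) :=
  exists_congr fun d ↦ by
    rw [hasInjectiveDimensionLT_iff.{u + 1}]
    exact ⟨fun h i hi N e ↦ (h N i hi).elim _ _,
      fun h N i hi ↦ subsingleton_of_forall_eq 0 fun e ↦ h i hi e⟩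

/-- The right module structures on `S` and on `Sᵐᵒᵖ` agree. -/
def rightSelfEquiv (S : Type u) [Ring S] : S ≃ₗ[Sᵐᵒᵖ] Sᵐᵒᵖ :=
  { MulOpposite.opAddEquiv with
    map_smul' := fun _ _ ↦ rfl }

lemma hasFinInjDim_obj_of_isGorensteinRing {R S : Type u} [Ring R] [Ring S]
    (hR : IsGorensteinRing R) (hS : IsGorensteinRing S)
    {L : ModuleCat.{u} Rᵐᵒᵖ ⥤ ModuleCat.{u} Sᵐᵒᵖ} {G : ModuleCat.{u} Sᵐᵒᵖ ⥤ ModuleCat.{u} Rᵐᵒᵖ}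
    [L.Additive] [G.Additive] [PreservesFiniteLimits L] [PreservesFiniteColimits L]
    [G.PreservesEpimorphisms] (adj : L ⊣ G) (n : ℕ) (E : ModuleCat.{u} Rᵐᵒᵖ)
    [HasInjectiveDimensionLT E (n + 1)] : HasFinInjDim Sᵐᵒᵖ (L.obj E) := by
  obtain ⟨_, _, _, hR⟩ := hR
  obtain ⟨_, _, hS, _⟩ := hS
  obtain ⟨a, _⟩ := (hasFinInjDim_iff _).1 hR
  obtain ⟨d, _⟩ := (hasFinInjDim_iff _).1 hS
  have : HasInjectiveDimensionLT (ModuleCat.of R Rᵐᵒᵖ) (a + 1) :=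
    hasInjectiveDimensionLT_of_iso (MulOpposite.opLinearEquiv R).toModuleIso _
  have : HasInjectiveDimensionLT (ModuleCat.of Sᵐᵒᵖ Sᵐᵒᵖ) (d + 1) :=
    hasInjectiveDimensionLT_of_iso (rightSelfEquiv S).toModuleIso _
  have hinj (J : ModuleCat.{u} Rᵐᵒᵖ) [Injective J] : HasInjectiveDimensionLT (L.obj J) (d + 1) :=
    hasInjectiveDimensionLT_of_syzygyFactorsThroughFree adj a J
      (syzygyFactorsThroughFree_of_injective a J)
  suffices HasInjectiveDimensionLT (L.obj E) (d + n + 1) from (hasFinInjDim_iff _).2 ⟨_, this⟩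
  induction n generalizing E with
  | zero =>
    have : Injective E := injective_iff_hasInjectiveDimensionLT_one.2 inferInstance
    exact hinj E
  | succ n ih =>
    obtain ⟨J, _, j, _⟩ := EnoughInjectives.presentation E
    have hT : (ShortComplex.mk j (cokernel.π j) (cokernel.condition j)).ShortExact :=
      { exact := ShortComplex.exact_cokernel j }
    have := (hT.hasInjectiveDimensionLT_X₃_iff n inferInstance).2 inferInstance
    have := hinj J
    exact (hT.map_of_exact L).hasInjectiveDimensionLT_X₁ (d + n + 1) (ih _)
      (hasInjectiveDimensionLT_of_ge (L.obj J) (d + 1) _ (by lia))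

theorem gorensteinInjective_iff_of_fullyFaithful_left_adjoint_exact
    {R S : Type u} [Ring R] [Ring S]
    (hR : IsGorensteinRing R) (hS : IsGorensteinRing S)
    (L : ModuleCat.{u} Rᵐᵒᵖ ⥤ ModuleCat.{u} Sᵐᵒᵖ)
    (G : ModuleCat.{u} Sᵐᵒᵖ ⥤ ModuleCat.{u} Rᵐᵒᵖ)
    (R' : ModuleCat.{u} Rᵐᵒᵖ ⥤ ModuleCat.{u} Sᵐᵒᵖ)
    [L.Additive] [G.Additive] [R'.Additive]
    (adj₁ : L ⊣ G) (adj₂ : G ⊣ R')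
    [G.Full] [G.Faithful]
    [PreservesFiniteLimits L] [PreservesFiniteColimits L]
    (m : ModuleCat.{u} Sᵐᵒᵖ) :
    IsGorensteinInjective Sᵐᵒᵖ m ↔ IsGorensteinInjective Rᵐᵒᵖ (G.obj m) := by
  have : G.IsRightAdjoint := adj₁.isRightAdjoint
  have : G.IsLeftAdjoint := adj₂.isLeftAdjoint
  refine ⟨fun hm E hE i hi ↦ ?_, fun hm E hE i hi ↦ ?_⟩
  · rw [subsingleton_ext_iff_of_adjunction adj₁]
    obtain ⟨n, _⟩ := (hasFinInjDim_iff _).1 hE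
    exact hm _ (hasFinInjDim_obj_of_isGorensteinRing hR hS adj₁ n E) i hi
  · have hGE : HasFinInjDim Rᵐᵒᵖ (G.obj E) := by
      obtain ⟨d, hd⟩ := hE
      exact ⟨d, fun N i hi ↦ (subsingleton_ext_iff_of_adjunction adj₁ N E i).2 (hd _ i hi)⟩
    have h := (subsingleton_ext_iff_of_adjunction adj₁ _ m i).1 (hm _ hGE i hi)
    let c : L.obj (G.obj E) ≅ E := asIso (adj₁.counit.app E)
    refine subsingleton_of_forall_eq 0 fun e ↦ ?_
    rw [← e.mk₀_id_comp, ← c.inv_hom_id, ← Ext.mk₀_comp_mk₀,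
      Ext.comp_assoc _ _ _ _ _ (by lia),
      h.elim ((Ext.mk₀ c.hom).comp e (zero_add i)) 0, Ext.comp_zero]
    lia
end

section
/- Under the Setup, assume in addition that the injective dimension of R both as a right R-module and as a left R-module is at most n (R is n-Gorenstein). Then the right derived functors of R′ vanish in degrees above n: R^j R′(m) = 0 for every right R-module m and every j > n. -/
/-!
Statement 6: Under the Setup, assume in addition that R is n-Gorenstein, i.e. the injective
dimension of R as a right R-module and as a left R-module is at most n.  Then the right
derived functors of R′ vanish in degrees above n: R^j R′(m) = 0 for every right R-module m
and every j > n.  Right A-modules are formalized as objects of `ModuleCat Aᵐᵒᵖ`; injective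
dimension ≤ n is expressed by the vanishing of Ext^i(N, −) for i > n.
-/

open CategoryTheory CategoryTheory.Abelian CategoryTheory.Limits

universe u

section ExtDimensionShifting

variable {A : Type u} [Ring A] {X Y Z : Type u} [AddCommGroup X] [AddCommGroup Y] [AddCommGroup Z]
  [Module A X] [Module A Y] [Module A Z] {f : X →ₗ[A] Y} {g : Y →ₗ[A] Z}

/-- The short exact sequence in `ModuleCat` attached to an exact pair of linear maps. -/
theorem Function.Exact.shortExact_moduleCat (hfg : Function.Exact f g) (hf : Function.Injective f)
    (hg : Function.Surjective g) :
    (ShortComplex.mk (ModuleCat.ofHom f) (ModuleCat.ofHom g)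
      (by rw [← ModuleCat.ofHom_comp, hfg.linearMap_comp_eq_zero]; rfl)).ShortExact :=
  ModuleCat.shortComplex_shortExact _ hfg hf hg

theorem subsingleton_ext_left_of_exact (hfg : Function.Exact f g) (hf : Function.Injective f)
    (hg : Function.Surjective g) (M : ModuleCat.{u} A) (i : ℕ)
    (hY : Subsingleton (Ext (ModuleCat.of A Y) M i))
    (hZ : Subsingleton (Ext (ModuleCat.of A Z) M (i + 1))) :
    Subsingleton (Ext (ModuleCat.of A X) M i) := by
  refine subsingleton_of_forall_eq 0 fun e ↦ ?_
  obtain ⟨y, rfl⟩ := Ext.contravariant_sequence_exact₁ (hfg.shortExact_moduleCat hf hg) M e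
    (add_comm 1 i) (hZ.elim _ _)
  rw [hY.elim y 0, Ext.comp_zero]

theorem subsingleton_ext_right_of_exact (hfg : Function.Exact f g) (hf : Function.Injective f)
    (hg : Function.Surjective g) (M : ModuleCat.{u} A) (i : ℕ)
    (hY : Subsingleton (Ext (ModuleCat.of A Y) M (i + 1)))
    (hX : Subsingleton (Ext (ModuleCat.of A X) M i)) :
    Subsingleton (Ext (ModuleCat.of A Z) M (i + 1)) := by
  refine subsingleton_of_forall_eq 0 fun e ↦ ?_
  obtain ⟨x, rfl⟩ := Ext.contravariant_sequence_exact₃ (hfg.shortExact_moduleCat hf hg) M e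
    (hY.elim _ _) (add_comm 1 i)
  rw [hX.elim x 0, Ext.comp_zero]

theorem subsingleton_ext_kernel_of_exact (hfg : Function.Exact f g) (hf : Function.Injective f)
    (hg : Function.Surjective g) (N : ModuleCat.{u} A) (i : ℕ)
    (hZ : Subsingleton (Ext N (ModuleCat.of A Z) i))
    (hY : Subsingleton (Ext N (ModuleCat.of A Y) (i + 1))) :
    Subsingleton (Ext N (ModuleCat.of A X) (i + 1)) := by
  refine subsingleton_of_forall_eq 0 fun e ↦ ?_
  obtain ⟨z, rfl⟩ := Ext.covariant_sequence_exact₁ N (hfg.shortExact_moduleCat hf hg) e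
    (hY.elim _ _) rfl
  rw [hZ.elim z 0, Ext.zero_comp]

theorem subsingleton_ext_cokernel_of_exact (hfg : Function.Exact f g) (hf : Function.Injective f)
    (hg : Function.Surjective g) (N : ModuleCat.{u} A) (i : ℕ)
    (hY : Subsingleton (Ext N (ModuleCat.of A Y) i))
    (hX : Subsingleton (Ext N (ModuleCat.of A X) (i + 1))) :
    Subsingleton (Ext N (ModuleCat.of A Z) i) := by
  refine subsingleton_of_forall_eq 0 fun e ↦ ?_
  obtain ⟨y, rfl⟩ := Ext.covariant_sequence_exact₃ N (hfg.shortExact_moduleCat hf hg) e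
    rfl (hX.elim _ _)
  rw [hY.elim y 0, Ext.zero_comp]

/-- If `Ext¹` of the cokernel vanishes, then linear maps extend along an injection. -/
theorem exists_comp_eq_of_subsingleton_ext_one (hfg : Function.Exact f g)
    (hf : Function.Injective f) (hg : Function.Surjective g)
    {M : Type u} [AddCommGroup M] [Module A M]
    (hZ : Subsingleton (Ext (ModuleCat.of A Z) (ModuleCat.of A M) 1)) (h : X →ₗ[A] M) :
    ∃ k : Y →ₗ[A] M, k ∘ₗ f = h := by
  obtain ⟨y, hy⟩ := Ext.contravariant_sequence_exact₁ (hfg.shortExact_moduleCat hf hg)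
    (ModuleCat.of A M) (Ext.mk₀ (ModuleCat.ofHom h)) (add_zero 1) (hZ.elim _ _)
  obtain ⟨k, rfl⟩ := (Ext.mk₀_bijective _ _).2 y
  rw [Ext.mk₀_comp_mk₀] at hy
  exact ⟨k.hom, congrArg ModuleCat.Hom.hom ((Ext.mk₀_bijective _ _).1 hy)⟩

/-- `Ext¹` of a quotient of a projective module vanishes as soon as linear maps from the kernel
extend. -/
theorem subsingleton_ext_one_of_extends [Module.Projective A Y] (hfg : Function.Exact f g)
    (hf : Function.Injective f) (hg : Function.Surjective g)
    {M : Type u} [AddCommGroup M] [Module A M]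
    (hM : ∀ h : X →ₗ[A] M, ∃ k : Y →ₗ[A] M, k ∘ₗ f = h) :
    Subsingleton (Ext (ModuleCat.of A Z) (ModuleCat.of A M) 1) := by
  have : Projective (ModuleCat.of A Y) := (IsProjective.iff_projective Y).1 inferInstance
  refine subsingleton_of_forall_eq 0 fun e ↦ ?_
  obtain ⟨x, rfl⟩ := Ext.contravariant_sequence_exact₃ (hfg.shortExact_moduleCat hf hg) _ e
    (Ext.eq_zero_of_projective _) (add_zero 1)
  obtain ⟨h, rfl⟩ := (Ext.mk₀_bijective _ _).2 x
  obtain ⟨k, hk⟩ := hM h.hom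
  have : h = ModuleCat.ofHom f ≫ ModuleCat.ofHom k := by
    ext x
    exact (LinearMap.congr_fun hk x).symm
  rw [this, ← Ext.mk₀_comp_mk₀, ← Ext.comp_assoc_of_third_deg_zero]
  have h0 := (hfg.shortExact_moduleCat hf hg).extClass_comp
  dsimp only at h0
  rw [h0, Ext.zero_comp]

theorem subsingleton_ext_of_projective [Module.Projective A Y] (M : ModuleCat.{u} A) (i : ℕ) :
    Subsingleton (Ext (ModuleCat.of A Y) M (i + 1)) :=
  have : Projective (ModuleCat.of A Y) := (IsProjective.iff_projective Y).1 inferInstance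
  Ext.subsingleton_of_projective _ _ _

end ExtDimensionShifting

section RightModules

variable (R : Type u) [Ring R]

instance free_self_mulOpposite : Module.Free Rᵐᵒᵖ R :=
  Module.Free.of_equiv
    ({ toFun := MulOpposite.unop
       invFun := MulOpposite.op
       map_add' := fun _ _ ↦ rfl
       map_smul' := fun _ _ ↦ rfl
       left_inv := fun _ ↦ rfl
       right_inv := fun _ ↦ rfl } : Rᵐᵒᵖ ≃ₗ[Rᵐᵒᵖ] R)

instance finite_self_mulOpposite : Module.Finite Rᵐᵒᵖ R :=
  ⟨⟨{1}, by
    rw [Finset.coe_singleton, Submodule.eq_top_iff']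
    exact fun x ↦ Submodule.mem_span_singleton.2 ⟨MulOpposite.op x, by simp⟩⟩⟩

variable {R}

theorem exists_surjective_pi_mulOpposite (X : Type u) [AddCommGroup X] [Module Rᵐᵒᵖ X]
    [Module.Finite Rᵐᵒᵖ X] :
    ∃ (k : ℕ) (p : (Fin k → R) →ₗ[Rᵐᵒᵖ] X), Function.Surjective p := by
  obtain ⟨k, p, hp⟩ := Module.Finite.exists_fin' Rᵐᵒᵖ X
  let e : (Fin k → R) →ₗ[Rᵐᵒᵖ] (Fin k → Rᵐᵒᵖ) :=
    { toFun := fun v i ↦ MulOpposite.op (v i)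
      map_add' := fun _ _ ↦ rfl
      map_smul' := fun _ _ ↦ rfl }
  exact ⟨k, p ∘ₗ e, hp.comp fun v ↦ ⟨fun i ↦ (v i).unop, rfl⟩⟩

/-- The map of right modules `R → M` sending `1` to `x`. -/
def rightToSpanSingleton {M : Type u} [AddCommGroup M] [Module Rᵐᵒᵖ M] (x : M) : R →ₗ[Rᵐᵒᵖ] M where
  toFun r := MulOpposite.op r • x
  map_add' r s := by simp [add_smul]
  map_smul' r s := by simp [mul_smul]

theorem rightToSpanSingleton_one {M : Type u} [AddCommGroup M] [Module Rᵐᵒᵖ M] (x : M) :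
    rightToSpanSingleton x (1 : R) = x :=
  one_smul Rᵐᵒᵖ x

theorem comp_rightToSpanSingleton {M N : Type u} [AddCommGroup M] [Module Rᵐᵒᵖ M]
    [AddCommGroup N] [Module Rᵐᵒᵖ N] (f : M →ₗ[Rᵐᵒᵖ] N) (x : M) :
    f ∘ₗ rightToSpanSingleton (R := R) x = rightToSpanSingleton (f x) :=
  LinearMap.ext fun r ↦ f.map_smul (MulOpposite.op r) x

theorem rightToSpanSingleton_zero {M : Type u} [AddCommGroup M] [Module Rᵐᵒᵖ M] :
    rightToSpanSingleton (R := R) (0 : M) = 0 :=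
  LinearMap.ext fun r ↦ smul_zero (MulOpposite.op r)

/-- The left `R`-module of `R`-valued linear forms on a right `R`-module. -/
abbrev RightDual (R X : Type u) [Ring R] [AddCommGroup X] [Module Rᵐᵒᵖ X] : Type u :=
  X →ₗ[Rᵐᵒᵖ] R

/-- Precomposition, as a map of left modules between duals of right modules. -/
def RightDual.map {X Y : Type u} [AddCommGroup X] [AddCommGroup Y] [Module Rᵐᵒᵖ X]
    [Module Rᵐᵒᵖ Y] (f : X →ₗ[Rᵐᵒᵖ] Y) : RightDual R Y →ₗ[R] RightDual R X where
  toFun h := h ∘ₗ f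
  map_add' _ _ := rfl
  map_smul' _ _ := rfl

/-- Linear forms on `Rᵏ` are given by their values on the standard basis. -/
def RightDual.piEquiv (k : ℕ) : RightDual R (Fin k → R) ≃ₗ[R] (Fin k → R) where
  toFun h i := h (Pi.single i 1)
  map_add' _ _ := rfl
  map_smul' _ _ := rfl
  invFun c :=
    { toFun := fun v ↦ ∑ i, c i * v i
      map_add' := fun v w ↦ by simp [mul_add, Finset.sum_add_distrib]
      map_smul' := fun r v ↦ by simp [Finset.sum_mul, mul_assoc] }
  left_inv h := by
    refine LinearMap.ext fun (v : Fin k → R) ↦ ?_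
    have hv : h v = ∑ i, h (Pi.single i (v i)) := by
      rw [← map_sum h (fun i ↦ (Pi.single i (v i) : Fin k → R)), Finset.univ_sum_single]
    change ∑ i, h (Pi.single i 1) * v i = h v
    rw [hv]
    refine Finset.sum_congr rfl fun i _ ↦ ?_
    have : Pi.single i (v i) = MulOpposite.op (v i) • (Pi.single i 1 : Fin k → R) := by
      rw [← Pi.single_smul]; simp
    rw [this, map_smul]; rfl
  right_inv c := by
    ext i
    simp [Pi.single_apply]

/-- A left linear form on the dual of `Rᵏ` is the evaluation at some vector. -/
theorem RightDual.exists_eval_eq {k : ℕ} (φ : RightDual R (Fin k → R) →ₗ[R] R) :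
    ∃ v : Fin k → R, ∀ h, φ h = h v := by
  let c (i : Fin k) : RightDual R (Fin k → R) := (RightDual.piEquiv k).symm (Pi.single i 1)
  have hc (i : Fin k) (v : Fin k → R) : c i v = v i := by
    simp [c, RightDual.piEquiv, Pi.single_apply]
  refine ⟨fun i ↦ φ (c i), fun h ↦ ?_⟩
  have hh : h = ∑ i, h (Pi.single i 1) • c i := by
    apply (RightDual.piEquiv k).injective
    ext j
    simp [RightDual.piEquiv, hc, Pi.single_apply]
  conv_lhs => rw [hh, map_sum]
  conv_rhs => rw [hh]
  simp [hc]

/-- Linear forms separate the vectors of `Rᵏ`. -/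
theorem RightDual.pi_ext {k : ℕ} {v w : Fin k → R}
    (h : ∀ g : RightDual R (Fin k → R), g v = g w) : v = w := by
  ext i
  exact h (LinearMap.proj i)

instance (k : ℕ) : Module.Free R (RightDual R (Fin k → R)) :=
  Module.Free.of_equiv (RightDual.piEquiv k).symm

end RightModules

section MaximalCohenMacaulay

variable {R : Type u} [Ring R]

/-- A finitely generated right module `X` is maximal Cohen–Macaulay if `Extⁱ(X, R) = 0` for
all `i > 0`. -/
def IsMaximalCohenMacaulay (R X : Type u) [Ring R] [AddCommGroup X] [Module Rᵐᵒᵖ X] : Prop :=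
  Module.Finite Rᵐᵒᵖ X ∧
    ∀ i : ℕ, Subsingleton (Ext (ModuleCat.of Rᵐᵒᵖ X) (ModuleCat.of Rᵐᵒᵖ R) (i + 1))

variable {X : Type u} [AddCommGroup X] [Module Rᵐᵒᵖ X]

theorem IsMaximalCohenMacaulay.ker [IsNoetherianRing Rᵐᵒᵖ] (hX : IsMaximalCohenMacaulay R X)
    {k : ℕ} {p : (Fin k → R) →ₗ[Rᵐᵒᵖ] X} (hp : Function.Surjective p) :
    IsMaximalCohenMacaulay R p.ker :=
  ⟨inferInstance, fun i ↦ subsingleton_ext_left_of_exact p.exact_subtype_ker_map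
    p.ker.injective_subtype hp _ _ (subsingleton_ext_of_projective _ _) (hX.2 (i + 1))⟩

theorem RightDual.map_injective {Y : Type u} [AddCommGroup Y] [Module Rᵐᵒᵖ Y]
    {p : Y →ₗ[Rᵐᵒᵖ] X} (hp : Function.Surjective p) :
    Function.Injective (RightDual.map (R := R) p) :=
  fun _ _ h ↦ (LinearMap.cancel_right hp).1 h

theorem RightDual.map_exact {Y : Type u} [AddCommGroup Y] [Module Rᵐᵒᵖ Y]
    {p : Y →ₗ[Rᵐᵒᵖ] X} (hp : Function.Surjective p) :
    Function.Exact (RightDual.map (R := R) p) (RightDual.map p.ker.subtype) := by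
  intro h
  constructor
  · intro hh
    have hle : p.ker ≤ h.ker := fun y hy ↦ LinearMap.congr_fun hh ⟨y, hy⟩
    refine ⟨p.ker.liftQ h hle ∘ₗ (p.quotKerEquivOfSurjective hp).symm.toLinearMap, ?_⟩
    refine LinearMap.ext fun y ↦ ?_
    have : (p.quotKerEquivOfSurjective hp).symm (p y) = p.ker.mkQ y :=
      (LinearEquiv.symm_apply_eq _).2 rfl
    simp [RightDual.map, this]
  · rintro ⟨g, rfl⟩
    refine LinearMap.ext fun y ↦ ?_
    simp [RightDual.map]

theorem RightDual.map_ker_subtype_surjective (hX : IsMaximalCohenMacaulay R X)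
    {Y : Type u} [AddCommGroup Y] [Module Rᵐᵒᵖ Y] {p : Y →ₗ[Rᵐᵒᵖ] X}
    (hp : Function.Surjective p) : Function.Surjective (RightDual.map (R := R) p.ker.subtype) :=
  exists_comp_eq_of_subsingleton_ext_one p.exact_subtype_ker_map p.ker.injective_subtype hp
    (hX.2 0)

/-- The dual of a maximal Cohen–Macaulay right module has no higher extensions by `R`, provided
that `R` has finite injective dimension as a left module. -/
theorem IsMaximalCohenMacaulay.subsingleton_ext_dual [IsNoetherianRing Rᵐᵒᵖ] {n : ℕ}
    (hleft : ∀ (N : ModuleCat.{u} R) (i : ℕ), n < i → Subsingleton (Ext N (ModuleCat.of R R) i))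
    (hX : IsMaximalCohenMacaulay R X) (i : ℕ) :
    Subsingleton (Ext (ModuleCat.of R (RightDual R X)) (ModuleCat.of R R) (i + 1)) := by
  obtain ⟨t, ht⟩ : ∃ t, n < i + 1 + t := ⟨n, by lia⟩
  induction t generalizing X i with
  | zero => exact hleft _ _ ht
  | succ t ih =>
    have := hX.1
    obtain ⟨k, p, hp⟩ := exists_surjective_pi_mulOpposite (R := R) X
    exact subsingleton_ext_left_of_exact (RightDual.map_exact hp) (RightDual.map_injective hp)
      (RightDual.map_ker_subtype_surjective hX hp) _ _ (subsingleton_ext_of_projective _ _)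
      (ih (hX.ker hp) (i + 1) (by lia))

/-- A maximal Cohen–Macaulay right module is torsionless. -/
theorem IsMaximalCohenMacaulay.eq_zero_of_forall_dual [IsNoetherianRing Rᵐᵒᵖ] {n : ℕ}
    (hleft : ∀ (N : ModuleCat.{u} R) (i : ℕ), n < i → Subsingleton (Ext N (ModuleCat.of R R) i))
    (hX : IsMaximalCohenMacaulay R X) (x : X) (hx : ∀ f : RightDual R X, f x = 0) : x = 0 := by
  have := hX.1
  obtain ⟨k, p, hp⟩ := exists_surjective_pi_mulOpposite (R := R) X
  have hK := hX.ker hp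
  have := hK.1
  obtain ⟨l, q, hq⟩ := exists_surjective_pi_mulOpposite (R := R) p.ker
  obtain ⟨v, rfl⟩ := hp x
  let φ : RightDual R (Fin k → R) →ₗ[R] R := LinearMap.applyₗ' R v
  let r : RightDual R (Fin k → R) →ₗ[R] RightDual R p.ker := RightDual.map p.ker.subtype
  have hr : Function.Surjective r := RightDual.map_ker_subtype_surjective hX hp
  have hle : r.ker ≤ φ.ker := by
    intro h hh
    obtain ⟨f, rfl⟩ := (RightDual.map_exact hp h).1 hh
    exact hx f
  let ψ : RightDual R p.ker →ₗ[R] R :=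
    r.ker.liftQ φ hle ∘ₗ (r.quotKerEquivOfSurjective hr).symm.toLinearMap
  have hψ (h) : ψ (r h) = φ h := by
    have : (r.quotKerEquivOfSurjective hr).symm (r h) = r.ker.mkQ h :=
      (LinearEquiv.symm_apply_eq _).2 rfl
    simp [ψ, this]
  obtain ⟨ψ', hψ'⟩ := exists_comp_eq_of_subsingleton_ext_one (RightDual.map_exact hq)
    (RightDual.map_injective hq) (RightDual.map_ker_subtype_surjective hK hq)
    ((hK.ker hq).subsingleton_ext_dual hleft 0) ψ
  obtain ⟨w, hw⟩ := RightDual.exists_eval_eq ψ'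
  have hv : v = q w := by
    refine RightDual.pi_ext fun g ↦ ?_
    calc g v = ψ (r g) := (hψ g).symm
      _ = ψ' (RightDual.map q (r g)) := (LinearMap.congr_fun hψ' _).symm
      _ = g (q w) := hw _
  rw [hv]
  exact (q w).2

/-- A maximal Cohen–Macaulay right module embeds into a finitely generated free module with
maximal Cohen–Macaulay cokernel. -/
theorem IsMaximalCohenMacaulay.exists_embedding [IsNoetherianRing R] [IsNoetherianRing Rᵐᵒᵖ]
    {n : ℕ}
    (hleft : ∀ (N : ModuleCat.{u} R) (i : ℕ), n < i → Subsingleton (Ext N (ModuleCat.of R R) i))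
    (hX : IsMaximalCohenMacaulay R X) :
    ∃ (k : ℕ) (f : X →ₗ[Rᵐᵒᵖ] (Fin k → R)), Function.Injective f ∧
      IsMaximalCohenMacaulay R ((Fin k → R) ⧸ f.range) := by
  have := hX.1
  obtain ⟨l, p, hp⟩ := exists_surjective_pi_mulOpposite (R := R) X
  have : Module.Finite R (RightDual R (Fin l → R)) :=
    Module.Finite.equiv (RightDual.piEquiv l).symm
  have : IsNoetherian R (RightDual R X) :=
    isNoetherian_of_injective (RightDual.map p) (RightDual.map_injective hp)
  obtain ⟨k, c, hc⟩ := Module.Finite.exists_fin' R (RightDual R X)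
  let b (i : Fin k) : RightDual R X := c (Pi.single i 1)
  let f : X →ₗ[Rᵐᵒᵖ] (Fin k → R) := LinearMap.pi b
  have hb (h : RightDual R X) : ∃ g : RightDual R (Fin k → R), g ∘ₗ f = h := by
    obtain ⟨a, rfl⟩ := hc h
    refine ⟨(RightDual.piEquiv k).symm a, LinearMap.ext fun x ↦ ?_⟩
    have ha : c a = ∑ i, a i • b i := by
      conv_lhs => rw [pi_eq_sum_univ' a, map_sum]
      simp [b]
    rw [ha]
    simp [RightDual.piEquiv, f]
  have hf : Function.Injective f := by
    refine (injective_iff_map_eq_zero f).2 fun x hx ↦ hX.eq_zero_of_forall_dual hleft x fun h ↦ ?_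
    obtain ⟨g, rfl⟩ := hb h
    simp [hx]
  refine ⟨k, f, hf, inferInstance, fun i ↦ ?_⟩
  cases i with
  | zero =>
    exact subsingleton_ext_one_of_extends f.exact_map_mkQ_range hf (Submodule.mkQ_surjective _) hb
  | succ i =>
    exact subsingleton_ext_right_of_exact f.exact_map_mkQ_range hf (Submodule.mkQ_surjective _) _ _
      (subsingleton_ext_of_projective _ _) (hX.2 i)

end MaximalCohenMacaulay

section InjectiveDimension

/-- Baer's criterion for injective dimension. -/
theorem hasInjectiveDimensionLT_of_subsingleton_ext_of_finite {A : Type u} [Ring A] {n : ℕ}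
    {M : ModuleCat.{u} A}
    (hM : ∀ (N : Type u) [AddCommGroup N] [Module A N] [Module.Finite A N],
      Subsingleton (Ext (ModuleCat.of A N) M (n + 1))) : HasInjectiveDimensionLT M (n + 1) := by
  induction n generalizing M with
  | zero =>
    have hB : Module.Baer A M := by
      intro I g
      obtain ⟨k, hk⟩ := exists_comp_eq_of_subsingleton_ext_one
        (LinearMap.exact_subtype_mkQ I) I.injective_subtype I.mkQ_surjective (hM _) g
      exact ⟨k, fun x hx ↦ LinearMap.congr_fun hk ⟨x, hx⟩⟩
    have := hB.injective
    have : Injective M := Module.injective_object_of_injective_module A M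
    infer_instance
  | succ n ih =>
    obtain ⟨I, _, f, _⟩ := EnoughInjectives.presentation M
    have hf : Function.Injective f.hom := (ModuleCat.mono_iff_injective f).1 inferInstance
    have hS := f.hom.exact_map_mkQ_range.shortExact_moduleCat hf (Submodule.mkQ_surjective _)
    refine (hS.hasInjectiveDimensionLT_X₃_iff n ‹_›).1 (ih fun N _ _ _ ↦ ?_)
    exact subsingleton_ext_cokernel_of_exact f.hom.exact_map_mkQ_range hf
      (Submodule.mkQ_surjective _) _ _
      (HasInjectiveDimensionLT.subsingleton I 1 _ (by lia) _) (hM N)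

/-- A functor with an exact left adjoint which preserves short exact sequences does not increase
injective dimension. -/
theorem CategoryTheory.HasInjectiveDimensionLT.map_of_adjunction {A B : Type u} [Ring A] [Ring B]
    {L : ModuleCat.{u} A ⥤ ModuleCat.{u} B} {G : ModuleCat.{u} B ⥤ ModuleCat.{u} A}
    (adj : L ⊣ G) [PreservesFiniteLimits L] [G.Additive] [PreservesFiniteLimits G]
    [PreservesFiniteColimits G] {d : ℕ} {M : ModuleCat.{u} B}
    (hM : HasInjectiveDimensionLT M (d + 1)) : HasInjectiveDimensionLT (G.obj M) (d + 1) := by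
  induction d generalizing M with
  | zero =>
    have : Injective M := injective_iff_hasInjectiveDimensionLT_one.2 hM
    have := adj.map_injective M this
    infer_instance
  | succ d ih =>
    obtain ⟨I, hI, f, _⟩ := EnoughInjectives.presentation M
    have hf : Function.Injective f.hom := (ModuleCat.mono_iff_injective f).1 inferInstance
    have hS := f.hom.exact_map_mkQ_range.shortExact_moduleCat hf (Submodule.mkQ_surjective _)
    exact ((hS.map_of_exact G).hasInjectiveDimensionLT_X₃_iff d (adj.map_injective I hI)).1
      (ih ((hS.hasInjectiveDimensionLT_X₃_iff d hI).2 hM))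

end InjectiveDimension

section Gorenstein

variable {R : Type u} [Ring R]

/-- A right module `M` is Cohen–Macaulay orthogonal if `Ext¹(X, M) = 0` for all maximal
Cohen–Macaulay modules `X`. -/
def IsCohenMacaulayOrthogonal (R : Type u) [Ring R] (M : ModuleCat.{u} Rᵐᵒᵖ) : Prop :=
  ∀ (X : Type u) [AddCommGroup X] [Module Rᵐᵒᵖ X], IsMaximalCohenMacaulay R X →
    Subsingleton (Ext (ModuleCat.of Rᵐᵒᵖ X) M 1)

theorem isCohenMacaulayOrthogonal_finsupp [IsNoetherianRing Rᵐᵒᵖ] (ι : Type u) :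
    IsCohenMacaulayOrthogonal R (ModuleCat.of Rᵐᵒᵖ (ι →₀ R)) := by
  classical
  intro X _ _ hX
  have := hX.1
  obtain ⟨k, p, hp⟩ := exists_surjective_pi_mulOpposite (R := R) X
  refine subsingleton_ext_one_of_extends p.exact_subtype_ker_map p.ker.injective_subtype hp
    fun h ↦ ?_
  choose b hb using fun i : ι ↦ RightDual.map_ker_subtype_surjective hX hp
    ((Finsupp.lapply i : (ι →₀ R) →ₗ[Rᵐᵒᵖ] R) ∘ₗ h)
  obtain ⟨s, hs⟩ := Module.Finite.fg_top (R := Rᵐᵒᵖ) (M := p.ker)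
  let t : Finset ι := s.biUnion fun x ↦ (h x).support
  refine ⟨∑ i ∈ t, (Finsupp.lsingle i : R →ₗ[Rᵐᵒᵖ] (ι →₀ R)) ∘ₗ b i, ?_⟩
  refine LinearMap.ext_on (s := (s : Set p.ker)) hs fun x hx ↦ ?_
  have hbx (i : ι) : b i x = h x i := LinearMap.congr_fun (hb i) x
  have hsupp : (h x).support ⊆ t := Finset.subset_biUnion_of_mem (fun x ↦ (h x).support) hx
  simp only [LinearMap.comp_apply, LinearMap.sum_apply, Submodule.subtype_apply,
    Finsupp.lsingle_apply, hbx]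
  exact (Finsupp.sum_of_support_subset (h x) hsupp Finsupp.single (by simp)).symm.trans
    (Finsupp.sum_single _)

theorem exists_surjective_finsupp_mulOpposite (M : Type u) [AddCommGroup M] [Module Rᵐᵒᵖ M] :
    ∃ (p : (M →₀ R) →ₗ[Rᵐᵒᵖ] M), Function.Surjective p := by
  exact ⟨Finsupp.lsum ℕ fun m ↦ rightToSpanSingleton m,
    fun m ↦ ⟨Finsupp.single m 1, by simp [rightToSpanSingleton_one]⟩⟩

section

variable [IsNoetherianRing R] [IsNoetherianRing Rᵐᵒᵖ] {n : ℕ}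
  (hleft : ∀ (N : ModuleCat.{u} R) (i : ℕ), n < i → Subsingleton (Ext N (ModuleCat.of R R) i))
  (hright : ∀ (N : ModuleCat.{u} Rᵐᵒᵖ) (i : ℕ), n < i →
    Subsingleton (Ext N (ModuleCat.of Rᵐᵒᵖ R) i))

include hleft

/-- Every module of finite injective dimension is Cohen–Macaulay orthogonal. -/
theorem IsCohenMacaulayOrthogonal.of_hasInjectiveDimensionLT {M : ModuleCat.{u} Rᵐᵒᵖ} {d : ℕ}
    (hM : HasInjectiveDimensionLT M (d + 1)) : IsCohenMacaulayOrthogonal R M := by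
  suffices ∀ i, i ≤ d → ∀ (X : Type u) [AddCommGroup X] [Module Rᵐᵒᵖ X],
      IsMaximalCohenMacaulay R X → Subsingleton (Ext (ModuleCat.of Rᵐᵒᵖ X) M (i + 1)) from
    this 0 (by lia)
  intro i hi
  induction hi using Nat.decreasingInduction with
  | self => exact fun X _ _ _ ↦ HasInjectiveDimensionLT.subsingleton M (d + 1) _ le_rfl _
  | of_succ i _ ih =>
    intro X _ _ hX
    obtain ⟨k, f, hf, hC⟩ := hX.exists_embedding hleft
    exact subsingleton_ext_left_of_exact f.exact_map_mkQ_range hf (Submodule.mkQ_surjective _) _ _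
      (subsingleton_ext_of_projective _ _) (ih _ hC)

theorem IsCohenMacaulayOrthogonal.ker {M : Type u} [AddCommGroup M] [Module Rᵐᵒᵖ M]
    (hM : IsCohenMacaulayOrthogonal R (ModuleCat.of Rᵐᵒᵖ M)) {ι : Type u}
    {p : (ι →₀ R) →ₗ[Rᵐᵒᵖ] M} (hp : Function.Surjective p) :
    IsCohenMacaulayOrthogonal R (ModuleCat.of Rᵐᵒᵖ p.ker) := by
  intro X _ _ hX
  obtain ⟨k, f, hf, hC⟩ := hX.exists_embedding hleft
  have := hC.1
  obtain ⟨l, q, hq⟩ := exists_surjective_pi_mulOpposite (R := R) ((Fin k → R) ⧸ f.range)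
  refine subsingleton_ext_left_of_exact f.exact_map_mkQ_range hf (Submodule.mkQ_surjective _) _ _
    (subsingleton_ext_of_projective _ _) ?_
  refine subsingleton_ext_kernel_of_exact p.exact_subtype_ker_map p.ker.injective_subtype hp _ _
    (hM _ hC) ?_
  exact subsingleton_ext_right_of_exact q.exact_subtype_ker_map q.ker.injective_subtype hq _ _
    (subsingleton_ext_of_projective _ _)
    (isCohenMacaulayOrthogonal_finsupp ι _ (hC.ker hq))

omit hleft [IsNoetherianRing R] in
include hright in
theorem IsCohenMacaulayOrthogonal.hasInjectiveDimensionLT {M : ModuleCat.{u} Rᵐᵒᵖ}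
    (hM : IsCohenMacaulayOrthogonal R M) : HasInjectiveDimensionLT M (n + 1) := by
  refine hasInjectiveDimensionLT_of_subsingleton_ext_of_finite fun N _ _ _ ↦ ?_
  have hN (i : ℕ) : Subsingleton (Ext (ModuleCat.of Rᵐᵒᵖ N) (ModuleCat.of Rᵐᵒᵖ R) (n + i + 1)) :=
    hright _ _ (by lia)
  clear hright
  induction n generalizing N with
  | zero => exact hM N ⟨inferInstance, by simpa using hN⟩
  | succ n ih =>
    obtain ⟨k, p, hp⟩ := exists_surjective_pi_mulOpposite (R := R) N
    refine subsingleton_ext_right_of_exact p.exact_subtype_ker_map p.ker.injective_subtype hp _ _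
      (subsingleton_ext_of_projective _ _) (ih _ _ _ inferInstance fun i ↦ ?_)
    refine subsingleton_ext_left_of_exact p.exact_subtype_ker_map p.ker.injective_subtype hp _ _
      (subsingleton_ext_of_projective _ _) ?_
    convert hN i using 2
    lia

include hright in
/-- Over an `n`-Gorenstein ring, modules of finite injective dimension have projective dimension
at most `n`. -/
theorem hasProjectiveDimensionLT_of_hasInjectiveDimensionLT {M : ModuleCat.{u} Rᵐᵒᵖ} {d : ℕ}
    (hM : HasInjectiveDimensionLT M (d + 1)) : HasProjectiveDimensionLT M (n + 1) := by
  suffices ∀ (k : ℕ) (M : ModuleCat.{u} Rᵐᵒᵖ), IsCohenMacaulayOrthogonal R M →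
      (∀ W, IsCohenMacaulayOrthogonal R W → Subsingleton (Ext M W (k + 1))) →
      HasProjectiveDimensionLT M (k + 1) from
    this n M (.of_hasInjectiveDimensionLT hleft hM) fun W hW ↦
      have := hW.hasInjectiveDimensionLT hright
      HasInjectiveDimensionLT.subsingleton W (n + 1) _ le_rfl _
  intro k
  induction k with
  | zero =>
    intro M hM hW
    obtain ⟨p, hp⟩ := exists_surjective_finsupp_mulOpposite (R := R) M
    obtain ⟨s, hs⟩ : ∃ s : M →ₗ[Rᵐᵒᵖ] (M →₀ R), p ∘ₗ s = LinearMap.id := by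
      obtain ⟨y, hy⟩ := Ext.covariant_sequence_exact₃ M
        (p.exact_subtype_ker_map.shortExact_moduleCat p.ker.injective_subtype hp)
        (Ext.mk₀ (𝟙 M)) (zero_add 1) ((hW _ (hM.ker hleft hp)).elim _ _)
      obtain ⟨s, rfl⟩ := (Ext.mk₀_bijective _ _).2 y
      rw [Ext.mk₀_comp_mk₀] at hy
      exact ⟨s.hom, congrArg ModuleCat.Hom.hom ((Ext.mk₀_bijective _ _).1 hy)⟩
    have : Module.Projective Rᵐᵒᵖ M := .of_split s p hs
    have : Projective M := (IsProjective.iff_projective (R := Rᵐᵒᵖ) M).1 this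
    infer_instance
  | succ k ih =>
    intro M hM hW
    obtain ⟨p, hp⟩ := exists_surjective_finsupp_mulOpposite (R := R) M
    have : Projective (ModuleCat.of Rᵐᵒᵖ (M →₀ R)) :=
      (IsProjective.iff_projective _).1 inferInstance
    refine ((p.exact_subtype_ker_map.shortExact_moduleCat p.ker.injective_subtype
      hp).hasProjectiveDimensionLT_X₃_iff k this).2 (ih _ (hM.ker hleft hp) fun W hW' ↦ ?_)
    exact subsingleton_ext_left_of_exact p.exact_subtype_ker_map p.ker.injective_subtype hp _ _
      (subsingleton_ext_of_projective _ _) (hW W hW')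

end

end Gorenstein

/-- If `G` sends a free module of rank one to a module of projective dimension at most `n`, then
the right derived functors of a right adjoint of `G` vanish above degree `n`. -/
theorem isZero_rightDerived_obj_of_adjunction {A S : Type u} [Ring A] [Ring S]
    {G : ModuleCat.{u} Sᵐᵒᵖ ⥤ ModuleCat.{u} A} {R' : ModuleCat.{u} A ⥤ ModuleCat.{u} Sᵐᵒᵖ}
    [G.Additive] [R'.Additive] (adj : G ⊣ R') {n : ℕ}
    (hG : HasProjectiveDimensionLT (G.obj (ModuleCat.of Sᵐᵒᵖ S)) (n + 1))
    (m : ModuleCat.{u} A) (j : ℕ) (hj : n < j) : IsZero ((R'.rightDerived j).obj m) := by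
  obtain ⟨j, rfl⟩ : ∃ i, j = i + 1 := ⟨j - 1, by lia⟩
  let I := injectiveResolution m
  refine IsZero.of_iso ?_ (I.isoRightDerivedObj R' (j + 1))
  refine HomologicalComplex.exactAt_iff_isZero_homology _ _ |>.1 ?_
  rw [HomologicalComplex.exactAt_iff' _ j (j + 1) (j + 1 + 1) (by simp) (by simp),
    ShortComplex.moduleCat_exact_iff]
  intro (x : R'.obj (I.cocomplex.X (j + 1)))
    (hx : (R'.map (I.cocomplex.d (j + 1) (j + 1 + 1))).hom x = 0)
  let φ : ModuleCat.of Sᵐᵒᵖ S ⟶ R'.obj (I.cocomplex.X (j + 1)) :=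
    ModuleCat.ofHom (rightToSpanSingleton x)
  have hφ : φ ≫ R'.map (I.cocomplex.d (j + 1) (j + 1 + 1)) = 0 :=
    ModuleCat.hom_ext ((comp_rightToSpanSingleton _ x).trans
      ((congrArg _ hx).trans rightToSpanSingleton_zero))
  have hφ' : (adj.homEquiv _ _).symm φ ≫ I.cocomplex.d (j + 1) (j + 1 + 1) = 0 := by
    rw [← adj.homEquiv_naturality_right_symm, hφ, adj.homEquiv_counit, G.map_zero, zero_comp]
  obtain ⟨g, hg⟩ := (I.extMk_eq_zero_iff _ _ rfl hφ' j rfl).1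
    (Ext.eq_zero_of_hasProjectiveDimensionLT _ (n + 1) (by lia))
  have hg' : adj.homEquiv _ _ g ≫ R'.map (I.cocomplex.d j (j + 1)) = φ := by
    rw [← adj.homEquiv_naturality_right, hg, Equiv.apply_symm_apply]
  exact ⟨(adj.homEquiv _ _ g).hom (1 : S),
    (LinearMap.congr_fun (congrArg ModuleCat.Hom.hom hg') (1 : S)).trans
      (rightToSpanSingleton_one x)⟩

theorem rightDerived_vanish_of_nGorenstein
    {R S : Type u} [Ring R] [Ring S]
    (hR : IsGorensteinRing R) (hS : IsGorensteinRing S)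
    (L : ModuleCat.{u} Rᵐᵒᵖ ⥤ ModuleCat.{u} Sᵐᵒᵖ)
    (G : ModuleCat.{u} Sᵐᵒᵖ ⥤ ModuleCat.{u} Rᵐᵒᵖ)
    (R' : ModuleCat.{u} Rᵐᵒᵖ ⥤ ModuleCat.{u} Sᵐᵒᵖ)
    [L.Additive] [G.Additive] [R'.Additive]
    (adj₁ : L ⊣ G) (adj₂ : G ⊣ R')
    [G.Full] [G.Faithful]
    [PreservesFiniteLimits L] [PreservesFiniteColimits L]
    (n : ℕ)
    (hright : ∀ (N : ModuleCat.{u} Rᵐᵒᵖ) (i : ℕ), n < i →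
      Subsingleton (Ext N (ModuleCat.of Rᵐᵒᵖ R) i))
    (hleft : ∀ (N : ModuleCat.{u} R) (i : ℕ), n < i →
      Subsingleton (Ext N (ModuleCat.of R R) i))
    (m : ModuleCat.{u} Rᵐᵒᵖ) (j : ℕ) (hj : n < j) :
    IsZero ((R'.rightDerived j).obj m) := by
  have := hR.1
  have := hR.2.1
  obtain ⟨d, hd⟩ := hS.2.2.1
  have hS' : HasInjectiveDimensionLT (ModuleCat.of Sᵐᵒᵖ S) (d + 1) :=
    .mk fun i hi N e ↦ (hd N i (by lia)).elim _ _
  have : PreservesLimitsOfSize.{0, 0} G := adj₁.rightAdjoint_preservesLimits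
  have : PreservesColimitsOfSize.{0, 0} G := adj₂.leftAdjoint_preservesColimits
  have := PreservesLimitsOfSize.preservesFiniteLimits G
  have := PreservesColimitsOfSize.preservesFiniteColimits G
  exact isZero_rightDerived_obj_of_adjunction adj₂
    (hasProjectiveDimensionLT_of_hasInjectiveDimensionLT hleft hright
      (hS'.map_of_adjunction adj₁)) m j hj
end

section
/- Let k be a field, let A and B be k-algebras, and set C = A ⊗_k B. Let M be a right A-module of finite projective dimension over A and N a right B-module of finite projective dimension over B. Then the right C-module M ⊗_k N has finite projective dimension over C. -/
/-!
Statement 14: Let k be a field, A and B k-algebras and C = A ⊗ₖ B.  If M is a right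
A-module of finite projective dimension over A and N a right B-module of finite projective
dimension over B, then the right C-module M ⊗ₖ N (with action
(m ⊗ n)·(a ⊗ b) = (m·a) ⊗ (n·b)) has finite projective dimension over C.
Right A-modules are formalized as left modules over Aᵐᵒᵖ; the k-actions on M and N are
required to be the ones coming through the algebra structure, and the right C-module
structure on M ⊗ₖ N is given as data satisfying the defining formula on pure tensors.
Finite projective dimension is expressed by Ext vanishing.
-/

open CategoryTheory CategoryTheory.Abelian TensorProduct MulOpposite

universe u

/-- The external tensor product of an `R`-module `M` and an `S`-module `N` over the base ring `k`:
a copy of `M ⊗[k] N` carrying the factorwise action of `R ⊗[k] S`. -/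
def ExternalTensor (k M N : Type*) [CommSemiring k] [AddCommMonoid M] [AddCommMonoid N]
    [Module k M] [Module k N] : Type _ :=
  M ⊗[k] N

namespace ExternalTensor

section Basic

variable {k R S : Type*} [CommRing k] [Ring R] [Ring S] [Algebra k R] [Algebra k S]
variable {M M' M'' : Type*} [AddCommGroup M] [Module k M] [Module R M] [IsScalarTower k R M]
  [AddCommGroup M'] [Module k M'] [Module R M'] [IsScalarTower k R M']
  [AddCommGroup M''] [Module k M''] [Module R M''] [IsScalarTower k R M'']
variable {N N' N'' : Type*} [AddCommGroup N] [Module k N] [Module S N] [IsScalarTower k S N]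
  [AddCommGroup N'] [Module k N'] [Module S N'] [IsScalarTower k S N']
  [AddCommGroup N''] [Module k N''] [Module S N''] [IsScalarTower k S N'']

noncomputable instance : AddCommGroup (ExternalTensor k M N) :=
  inferInstanceAs (AddCommGroup (M ⊗[k] N))

variable (k R S M N) in
/-- The factorwise action of `R ⊗[k] S` on `M ⊗[k] N`, as a ring homomorphism. -/
noncomputable def actionHom : R ⊗[k] S →ₐ[k] Module.End k (M ⊗[k] N) :=
  (Module.endTensorEndAlgHom (R := k) (S := k) (A := k) (M := M) (N := N)).comp
    (Algebra.TensorProduct.map (Algebra.lsmul k k M : R →ₐ[k] _) (Algebra.lsmul k k N : S →ₐ[k] _))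

noncomputable instance : Module (R ⊗[k] S) (ExternalTensor k M N) :=
  Module.compHom (M ⊗[k] N) (actionHom k R S M N).toRingHom

/-- The identity map from the tensor product to the external tensor product. -/
def of : M ⊗[k] N ≃+ ExternalTensor k M N := AddEquiv.refl _

theorem tmul_smul_of (r : R) (s : S) (x : M) (y : N) :
    (r ⊗ₜ[k] s) • (of (x ⊗ₜ[k] y) : ExternalTensor k M N) = of ((r • x) ⊗ₜ[k] (s • y)) :=
  rfl

/-- An additive map out of an external tensor product which is compatible with the actions of pure
tensors on pure tensors is linear. -/
theorem map_smul_of_tmul {X : Type*} [AddCommGroup X] {T : Type*} [Ring T] [Module T X]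
    (σ : R ⊗[k] S →+* T) (f : M ⊗[k] N →+ X)
    (hf : ∀ (r : R) (s : S) (x : M) (y : N),
      f ((r • x) ⊗ₜ[k] (s • y)) = σ (r ⊗ₜ[k] s) • f (x ⊗ₜ[k] y))
    (c : R ⊗[k] S) (t : ExternalTensor k M N) :
    f (of.symm (c • t)) = σ c • f (of.symm t) := by
  obtain ⟨t, rfl⟩ := of.surjective t
  induction c with
  | zero => simp
  | add c d hc hd => simp only [add_smul, map_add, hc, hd]
  | tmul r s =>
    induction t with
    | zero => simp
    | add t u ht hu => simp only [smul_add, map_add, ht, hu]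
    | tmul x y => simpa [tmul_smul_of] using hf r s x y

/-- Functoriality of the external tensor product. -/
noncomputable def map (f : M →ₗ[R] M') (g : N →ₗ[S] N') :
    ExternalTensor k M N →ₗ[R ⊗[k] S] ExternalTensor k M' N' where
  toFun t := of (TensorProduct.map (f.restrictScalars k) (g.restrictScalars k) (of.symm t))
  map_add' t u := by simp
  map_smul' c t :=
    map_smul_of_tmul (RingHom.id _)
      ((of : M' ⊗[k] N' ≃+ _).toAddMonoidHom.comp
        (TensorProduct.map (f.restrictScalars k) (g.restrictScalars k)).toAddMonoidHom)
      (fun r s x y => by simp [tmul_smul_of]) c t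

variable (k R S) in
/-- The external tensor product of free modules is free. -/
noncomputable def finsuppEquiv (ι κ : Type*) :
    ExternalTensor k (ι →₀ R) (κ →₀ S) ≃ₗ[R ⊗[k] S] (ι × κ →₀ R ⊗[k] S) where
  __ := of.symm.trans (finsuppTensorFinsupp k k R S ι κ).toAddEquiv
  map_smul' c t :=
    map_smul_of_tmul (RingHom.id _) (finsuppTensorFinsupp k k R S ι κ).toAddMonoidHom
      (fun r s x y => by ext ⟨i, j⟩; simp) c t

theorem projective [Module.Projective R M] [Module.Projective S N] :
    Module.Projective (R ⊗[k] S) (ExternalTensor k M N) := by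
  obtain ⟨f, hf⟩ := Module.projective_def'.mp ‹Module.Projective R M›
  obtain ⟨g, hg⟩ := Module.projective_def'.mp ‹Module.Projective S N›
  have : Module.Projective (R ⊗[k] S) (ExternalTensor k (M →₀ R) (N →₀ S)) :=
    .of_equiv (finsuppEquiv k R S M N).symm
  refine .of_split (map f g)
    (map (Finsupp.linearCombination R id) (Finsupp.linearCombination S id)) ?_
  ext t
  obtain ⟨t, rfl⟩ := of.surjective t
  change of (TensorProduct.map _ _ (TensorProduct.map _ _ t)) = of t
  rw [← LinearMap.comp_apply, ← TensorProduct.map_comp, ← LinearMap.restrictScalars_comp,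
    ← LinearMap.restrictScalars_comp, hf, hg]
  exact congrArg of (LinearMap.congr_fun TensorProduct.map_id t)

end Basic

section Exact

universe v

variable {k R S : Type v} [Field k] [Ring R] [Ring S] [Algebra k R] [Algebra k S]
variable {M₁ M₂ M₃ : Type v} [AddCommGroup M₁] [Module k M₁] [Module R M₁] [IsScalarTower k R M₁]
  [AddCommGroup M₂] [Module k M₂] [Module R M₂] [IsScalarTower k R M₂]
  [AddCommGroup M₃] [Module k M₃] [Module R M₃] [IsScalarTower k R M₃]
variable {N₁ N₂ N₃ : Type v} [AddCommGroup N₁] [Module k N₁] [Module S N₁] [IsScalarTower k S N₁]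
  [AddCommGroup N₂] [Module k N₂] [Module S N₂] [IsScalarTower k S N₂]
  [AddCommGroup N₃] [Module k N₃] [Module S N₃] [IsScalarTower k S N₃]

theorem exact_map_id {f : M₁ →ₗ[R] M₂} {g : M₂ →ₗ[R] M₃} (h : Function.Exact f g)
    (hg : Function.Surjective g) :
    Function.Exact (map (k := k) f (LinearMap.id : N₁ →ₗ[S] N₁)) (map (k := k) g (LinearMap.id : N₁ →ₗ[S] N₁)) :=
  rTensor_exact N₁ (f := f.restrictScalars k) (g := g.restrictScalars k) h hg

theorem exact_id_map {f : N₁ →ₗ[S] N₂} {g : N₂ →ₗ[S] N₃} (h : Function.Exact f g)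
    (hg : Function.Surjective g) :
    Function.Exact (map (k := k) (LinearMap.id : M₁ →ₗ[R] M₁) f) (map (k := k) (LinearMap.id : M₁ →ₗ[R] M₁) g) :=
  lTensor_exact M₁ (f := f.restrictScalars k) (g := g.restrictScalars k) h hg

theorem map_injective {f : M₁ →ₗ[R] M₂} {g : N₁ →ₗ[S] N₂} (hf : Function.Injective f)
    (hg : Function.Injective g) : Function.Injective (map (k := k) f g) :=
  TensorProduct.map_injective_of_flat_flat (f.restrictScalars k) (g.restrictScalars k) hf hg

theorem map_surjective {f : M₁ →ₗ[R] M₂} {g : N₁ →ₗ[S] N₂} (hf : Function.Surjective f)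
    (hg : Function.Surjective g) : Function.Surjective (map (k := k) f g) :=
  TensorProduct.map_surjective (g := f.restrictScalars k) (g' := g.restrictScalars k) hf hg

variable (N₁) in
/-- Tensoring with a module over the second factor preserves short exactness. -/
theorem shortExact_map_id {f : M₁ →ₗ[R] M₂} {g : M₂ →ₗ[R] M₃} (h : Function.Exact f g)
    (hf : Function.Injective f) (hg : Function.Surjective g) :
    (ModuleCat.shortComplexOfCompEqZero (map (k := k) f (LinearMap.id : N₁ →ₗ[S] N₁))
      (map (k := k) g LinearMap.id) (exact_map_id h hg).linearMap_comp_eq_zero).ShortExact :=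
  ModuleCat.shortComplex_shortExact _ (exact_map_id h hg)
    (map_injective hf Function.injective_id) (map_surjective hg Function.surjective_id)

variable (M₁) in
/-- Tensoring with a module over the first factor preserves short exactness. -/
theorem shortExact_id_map {f : N₁ →ₗ[S] N₂} {g : N₂ →ₗ[S] N₃} (h : Function.Exact f g)
    (hf : Function.Injective f) (hg : Function.Surjective g) :
    (ModuleCat.shortComplexOfCompEqZero (map (k := k) (LinearMap.id : M₁ →ₗ[R] M₁) f)
      (map (k := k) LinearMap.id g) (exact_id_map h hg).linearMap_comp_eq_zero).ShortExact :=
  ModuleCat.shortComplex_shortExact _ (exact_id_map h hg)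
    (map_injective Function.injective_id hf) (map_surjective Function.surjective_id hg)

end Exact

section Dimension

universe v

/-- The kernel of a free presentation of a module of projective dimension `≤ n + 1` has projective
dimension `≤ n`. -/
theorem hasProjectiveDimensionLE_ker {R : Type v} [Ring R] (M : Type v) [AddCommGroup M]
    [Module R M] (n : ℕ) (h : HasProjectiveDimensionLE (ModuleCat.of R M) (n + 1)) :
    HasProjectiveDimensionLE
      (ModuleCat.of R (Finsupp.linearCombination R (id : M → M)).ker) n :=
  ((LinearMap.shortExact_shortComplexKer
    (Finsupp.linearCombination_id_surjective R M)).hasProjectiveDimensionLT_X₃_iff n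
      ((IsProjective.iff_projective (M →₀ R)).mp inferInstance)).mp h

theorem projective_of_hasProjectiveDimensionLE_zero {R : Type v} [Ring R] (M : Type v)
    [AddCommGroup M] [Module R M] (h : HasProjectiveDimensionLE (ModuleCat.of R M) 0) :
    Module.Projective R M :=
  (IsProjective.iff_projective M).mpr (projective_iff_hasProjectiveDimensionLE_zero _ |>.mpr h)

variable {k R S : Type v} [Field k] [Ring R] [Ring S] [Algebra k R] [Algebra k S]

theorem hasProjectiveDimensionLE_of_projective_left
    (M : Type v) [AddCommGroup M] [Module k M] [Module R M] [IsScalarTower k R M]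
    [Module.Projective R M] (n : ℕ)
    (N : Type v) [AddCommGroup N] [Module k N] [Module S N] [IsScalarTower k S N]
    (hN : HasProjectiveDimensionLE (ModuleCat.of S N) n) :
    HasProjectiveDimensionLE (ModuleCat.of (R ⊗[k] S) (ExternalTensor k M N)) n := by
  induction n generalizing N with
  | zero =>
    have := projective_of_hasProjectiveDimensionLE_zero N hN
    rw [← projective_iff_hasProjectiveDimensionLE_zero]
    exact (IsProjective.iff_projective _).mp projective
  | succ n ih =>
    let p := Finsupp.linearCombination S (id : N → N)
    have hS := shortExact_id_map (k := k) (R := R) M (N₁ := p.ker)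
      (LinearMap.exact_subtype_ker_map p)
      p.ker.injective_subtype (Finsupp.linearCombination_id_surjective S N)
    have : Projective (ModuleCat.of (R ⊗[k] S) (ExternalTensor k M (N →₀ S))) :=
      (IsProjective.iff_projective _).mp projective
    exact hS.hasProjectiveDimensionLT_X₃ (n + 1) (ih _ (hasProjectiveDimensionLE_ker N n hN))
      (hasProjectiveDimensionLT_of_ge (ModuleCat.of (R ⊗[k] S) (ExternalTensor k M (N →₀ S))) 1 _
        (by lia))

/-- Over a field, projective dimension is subadditive under external tensor products. -/
theorem hasProjectiveDimensionLE (m n : ℕ)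
    (M : Type v) [AddCommGroup M] [Module k M] [Module R M] [IsScalarTower k R M]
    (N : Type v) [AddCommGroup N] [Module k N] [Module S N] [IsScalarTower k S N]
    (hM : HasProjectiveDimensionLE (ModuleCat.of R M) m)
    (hN : HasProjectiveDimensionLE (ModuleCat.of S N) n) :
    HasProjectiveDimensionLE (ModuleCat.of (R ⊗[k] S) (ExternalTensor k M N)) (m + n) := by
  induction m generalizing M with
  | zero =>
    have := projective_of_hasProjectiveDimensionLE_zero M hM
    rw [zero_add]
    exact hasProjectiveDimensionLE_of_projective_left M n N hN
  | succ m ih =>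
    let p := Finsupp.linearCombination R (id : M → M)
    have hS := shortExact_map_id (k := k) (S := S) N (M₁ := p.ker)
      (LinearMap.exact_subtype_ker_map p)
      p.ker.injective_subtype (Finsupp.linearCombination_id_surjective R M)
    have := hasProjectiveDimensionLE_of_projective_left (k := k) (R := R) (M →₀ R) n N hN
    rw [add_right_comm]
    exact hS.hasProjectiveDimensionLT_X₃ (m + n + 1) (ih _ (hasProjectiveDimensionLE_ker M m hM))
      (hasProjectiveDimensionLT_of_ge (ModuleCat.of (R ⊗[k] S) (ExternalTensor k (M →₀ R) N))
        (n + 1) _ (by lia))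

end Dimension

end ExternalTensor

/-- `HasFinProjDim` in terms of Mathlib's `HasProjectiveDimensionLE`. -/
theorem hasFinProjDim_iff (A : Type u) [Ring A] (M : ModuleCat.{u} A) :
    HasFinProjDim A M ↔ ∃ d : ℕ, HasProjectiveDimensionLE M d :=
  exists_congr fun d =>
    ⟨fun h => .mk fun i hi Y _ => (h Y i hi).elim _ _,
      fun _ Y i hi => HasProjectiveDimensionLT.subsingleton M (d + 1) i hi Y⟩

theorem tensor_finProjDim
    {k : Type u} [Field k] {A B : Type u} [Ring A] [Ring B]
    [Algebra k A] [Algebra k B]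
    (M : Type u) [AddCommGroup M] [Module k M] [Module Aᵐᵒᵖ M]
    (hMk : ∀ (c : k) (x : M), op (algebraMap k A c) • x = c • x)
    (N : Type u) [AddCommGroup N] [Module k N] [Module Bᵐᵒᵖ N]
    (hNk : ∀ (c : k) (y : N), op (algebraMap k B c) • y = c • y)
    [Module (A ⊗[k] B)ᵐᵒᵖ (M ⊗[k] N)]
    (hTens : ∀ (a : A) (b : B) (x : M) (y : N),
      op (a ⊗ₜ[k] b) • (x ⊗ₜ[k] y) = (op a • x) ⊗ₜ[k] (op b • y))
    (hM : HasFinProjDim Aᵐᵒᵖ (ModuleCat.of Aᵐᵒᵖ M))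
    (hN : HasFinProjDim Bᵐᵒᵖ (ModuleCat.of Bᵐᵒᵖ N)) :
    HasFinProjDim (A ⊗[k] B)ᵐᵒᵖ (ModuleCat.of (A ⊗[k] B)ᵐᵒᵖ (M ⊗[k] N)) := by
  have : IsScalarTower k Aᵐᵒᵖ M := .of_algebraMap_smul hMk
  have : IsScalarTower k Bᵐᵒᵖ N := .of_algebraMap_smul hNk
  obtain ⟨m, hm⟩ := (hasFinProjDim_iff _ _).mp hM
  obtain ⟨n, hn⟩ := (hasFinProjDim_iff _ _).mp hN
  let σ := (Algebra.TensorProduct.opAlgEquiv k k A B).toRingEquiv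
  have hE := ExternalTensor.hasProjectiveDimensionLE (k := k) m n M N hm hn
  have := RingHomInvPair.of_ringEquiv σ
  have : RingHomInvPair (RingHomClass.toRingHom σ.symm) (RingHomClass.toRingHom σ) :=
    RingHomInvPair.of_ringEquiv σ.symm
  let e : ExternalTensor k M N ≃ₛₗ[RingHomClass.toRingHom σ] M ⊗[k] N :=
    { ExternalTensor.of.symm with
      map_smul' := ExternalTensor.map_smul_of_tmul (RingHomClass.toRingHom σ) (AddMonoidHom.id _)
        fun a b x y => (hTens a.unop b.unop x y).symm }
  exact (hasFinProjDim_iff _ _).mpr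
    ⟨m + n, ModuleCat.hasProjectiveDimensionLE_of_semiLinearEquiv σ
      (M := ModuleCat.of _ (ExternalTensor k M N)) (N := ModuleCat.of _ (M ⊗[k] N)) e (m + n)⟩
end
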